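/- Let d ≥ 1, let 0 < c ≤ C, and let V : ℝ^d → ℝ satisfy c ≤ HV ≤ C, with Gibbs measure μ = Z^{−1} e^{−V(x)} dx where Z = ∫ e^{−V}. For t > 0 let p_t(x) = (2πt)^{−d/2} e^{−|x|²/(2t)} denote the Gaussian heat kernel, define V_t := −log(e^{−V} * p_t) for t > 0 and V₀ := V, and let μ_t := μ * N(0, t I_d) be the convolution of μ with the centered Gaussian of covariance t I_d, so that μ_t = Z^{−1} e^{−V_t(x)} dx. Then: (1) there exists a unique family of functions F_{s,t} : ℝ^d → ℝ^d, for s, t ∈ [0, ∞), satisfying F_{t,t}(x) = x and ∂_s F_{s,t}(x) = (1/2) ∇V_s(F_{s,t}(x)) for all s, t ∈ [0, ∞) and x ∈ ℝ^d; (2) F_{t₁,t₂} ∘ F_{t₂,t₃} = F_{t₁,t₃} for all t₁, t₂, t₃ ∈ [0, ∞), and in particular F_{t,s} = F_{s,t}^{−1}; (3) the pushforward of μ_t under F_{s,t} equals μ_s, i.e. (F_{s,t})_* μ_t = μ_s for all s, t ∈ [0, ∞). -/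

import Mathlib

open Set MeasureTheory

section Convexity

variable {E : Type*} [NormedAddCommGroup E] [InnerProductSpace ℝ E]

open scoped RealInnerProductSpace

theorem ConvexOn.exists_subgradient [CompleteSpace E] {f : E → ℝ} (hf : ConvexOn ℝ univ f)
    (hfc : Continuous f) (x : E) : ∃ g : E, ∀ y, f x + ⟪g, y - x⟫ ≤ f y := by
  have hS : Convex ℝ {p : E × ℝ | f p.1 < p.2} := by
    simpa using hf.convex_strict_epigraph
  have hSo : IsOpen {p : E × ℝ | f p.1 < p.2} :=
    isOpen_lt (hfc.comp continuous_fst) continuous_snd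
  obtain ⟨L, hL⟩ := geometric_hahn_banach_point_open (x := (x, f x)) hS hSo (by simp)
  set a := L (0, 1) with ha
  have hsplit : ∀ (y : E) (r : ℝ), L (y, r) = L (y, 0) + a * r := by
    intro y r
    have h : ((y, r) : E × ℝ) = (y, 0) + r • (0, 1) := by simp
    rw [h, map_add, map_smul, smul_eq_mul, mul_comm]
  have ha0 : 0 < a := by
    have h := hL (x, f x + 1) (by simp)
    rw [hsplit, hsplit x (f x + 1)] at h
    linarith
  have key : ∀ y, L (x, 0) + a * f x ≤ L (y, 0) + a * f y := by
    intro y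
    refine le_of_forall_pos_lt_add fun ε hε => ?_
    have h := hL (y, f y + ε / a) (by simp; positivity)
    rw [hsplit, hsplit y, mul_add, mul_div_cancel₀ _ ha0.ne'] at h
    linarith
  refine ⟨-(a⁻¹ • (InnerProductSpace.toDual ℝ E).symm (L.comp (ContinuousLinearMap.inl ℝ E ℝ))),
    fun y => ?_⟩
  have h := key y
  rw [inner_neg_left, real_inner_smul_left, InnerProductSpace.toDual_symm_apply]
  simp only [map_sub, ContinuousLinearMap.comp_apply, ContinuousLinearMap.inl_apply]
  have : f y - f x = a⁻¹ * (a * f y - a * f x) := by field_simp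
  have h2 : a⁻¹ * (a * f y - a * f x) ≥ a⁻¹ * (L (x, 0) - L (y, 0)) :=
    mul_le_mul_of_nonneg_left (by linarith) (by positivity)
  nlinarith

/-- `p` is a selection of gradients of a function that is squeezed between two quadratics at every
point. -/
theorem exists_forall_quadratic_bounds [FiniteDimensional ℝ E] {V : E → ℝ} {c C : ℝ}
    (hconv : ConvexOn ℝ univ (fun x => V x - c / 2 * ‖x‖ ^ 2))
    (hconc : ConcaveOn ℝ univ (fun x => V x - C / 2 * ‖x‖ ^ 2)) :
    ∃ p : E → E, ∀ x y, V x + ⟪p x, y - x⟫ + c / 2 * ‖y - x‖ ^ 2 ≤ V y ∧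
      V y ≤ V x + ⟪p x, y - x⟫ + C / 2 * ‖y - x‖ ^ 2 := by
  have hc1 : Continuous (fun x => V x - c / 2 * ‖x‖ ^ 2) :=
    continuousOn_univ.1 (hconv.continuousOn isOpen_univ)
  have hc2 : Continuous (fun x => -(V x - C / 2 * ‖x‖ ^ 2)) :=
    continuousOn_univ.1 (hconc.neg.continuousOn isOpen_univ)
  have hsq : ∀ x y : E, ‖y‖ ^ 2 = ‖x‖ ^ 2 + 2 * ⟪x, y - x⟫ + ‖y - x‖ ^ 2 := by
    intro x y
    have h := norm_add_sq_real x (y - x)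
    rwa [add_sub_cancel] at h
  have : ∀ x, ∃ p : E, ∀ y, V x + ⟪p, y - x⟫ + c / 2 * ‖y - x‖ ^ 2 ≤ V y ∧
      V y ≤ V x + ⟪p, y - x⟫ + C / 2 * ‖y - x‖ ^ 2 := by
    intro x
    obtain ⟨g₁, h₁⟩ := hconv.exists_subgradient hc1 x
    obtain ⟨g₂, h₂⟩ := ConvexOn.exists_subgradient (f := fun x => -(V x - C / 2 * ‖x‖ ^ 2))
      hconc.neg hc2 x
    set p := g₁ + c • x
    set q := C • x - g₂
    have hp : ∀ y, V x + ⟪p, y - x⟫ + c / 2 * ‖y - x‖ ^ 2 ≤ V y := by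
      intro y
      have h := h₁ y
      simp only [p, inner_add_left, real_inner_smul_left]
      have := hsq x y
      rw [this] at h
      linarith
    have hq : ∀ y, V y ≤ V x + ⟪q, y - x⟫ + C / 2 * ‖y - x‖ ^ 2 := by
      intro y
      have h := h₂ y
      simp only [q, inner_sub_left, real_inner_smul_left]
      have := hsq x y
      rw [this] at h
      linarith
    have hpq : p = q := by
      have h : ∀ t : ℝ, t * ‖p - q‖ ^ 2 ≤ (C - c) / 2 * t ^ 2 * ‖p - q‖ ^ 2 := by
        intro t
        have h1 := hp (x + t • (p - q))
        have h2 := hq (x + t • (p - q))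
        simp only [add_sub_cancel_left, real_inner_smul_right, norm_smul, mul_pow,
          Real.norm_eq_abs, sq_abs] at h1 h2
        have h3 : ⟪p, p - q⟫ - ⟪q, p - q⟫ = ‖p - q‖ ^ 2 := by
          rw [← inner_sub_left, real_inner_self_eq_norm_sq]
        have h4 : t * ⟪p, p - q⟫ - t * ⟪q, p - q⟫ = t * ‖p - q‖ ^ 2 := by
          rw [← h3]; ring
        linarith
      by_contra hne
      have hpos : 0 < ‖p - q‖ ^ 2 := by
        have := norm_pos_iff.2 (sub_ne_zero.2 hne)
        positivity
      have ht := h (1 / (1 + |C - c|))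
      have hA : 0 < 1 + |C - c| := by positivity
      have h4 : (C - c) ≤ |C - c| := le_abs_self _
      have h5 : 1 / (1 + |C - c|) ≤ (C - c) / 2 * (1 / (1 + |C - c|)) ^ 2 := by
        refine le_of_mul_le_mul_right ?_ hpos
        linarith
      have h6 : (1 + |C - c|) ≤ (C - c) / 2 := by
        field_simp at h5
        linarith
      have := abs_nonneg (C - c)
      linarith
    exact ⟨p, fun y => ⟨hp y, hpq ▸ hq y⟩⟩
  choose p hp using this
  exact ⟨p, hp⟩

end Convexity

section Flow

open Metric
open scoped NNReal Topology

variable {E : Type*} [NormedAddCommGroup E] [NormedSpace ℝ E]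

/-- Two-sided Grönwall inequality on `[0, T]`. -/
theorem norm_le_gronwallBound_abs_sub {T K ε : ℝ} {y y' : ℝ → E}
    (hy : ∀ s ∈ Icc 0 T, HasDerivWithinAt y (y' s) (Icc 0 T) s)
    (bound : ∀ s ∈ Icc 0 T, ‖y' s‖ ≤ K * ‖y s‖ + ε) {s t : ℝ} (hs : s ∈ Icc 0 T)
    (ht : t ∈ Icc 0 T) : ‖y s‖ ≤ gronwallBound ‖y t‖ K ε |s - t| := by
  have hcont : ContinuousOn y (Icc 0 T) := fun s hs => (hy s hs).continuousWithinAt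
  rcases le_total t s with h | h
  · have hsub : Icc t s ⊆ Icc 0 T := Icc_subset_Icc ht.1 hs.2
    rw [abs_of_nonneg (sub_nonneg.2 h)]
    refine norm_le_gronwallBound_of_norm_deriv_right_le (hcont.mono hsub) (fun r hr => ?_) le_rfl
      (fun r hr => bound r (hsub (Ico_subset_Icc_self hr))) s ⟨h, le_rfl⟩
    exact ((hy r (hsub (Ico_subset_Icc_self hr))).mono hsub).mono_of_mem_nhdsWithin
      (Icc_mem_nhdsGE_of_mem hr)
  · have hsub : Icc s t ⊆ Icc 0 T := Icc_subset_Icc hs.1 ht.2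
    rw [abs_of_nonpos (sub_nonpos.2 h), neg_sub]
    have hmaps : MapsTo (fun r => -r) (Icc (-t) (-s)) (Icc s t) := fun r hr =>
      ⟨by linarith [hr.2], by linarith [hr.1]⟩
    have key := norm_le_gronwallBound_of_norm_deriv_right_le (f := fun r => y (-r))
      (f' := fun r => -y' (-r)) (δ := ‖y t‖) (K := K) (ε := ε) (a := -t) (b := -s)
      ((hcont.mono hsub).comp continuous_neg.continuousOn hmaps) (fun r hr => ?_) (by simp)
      (fun r hr => ?_) (-s) ⟨by linarith, le_rfl⟩
    · simpa [sub_eq_neg_add, add_comm] using key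
    · have h1 := (hy (-r) (hsub (hmaps (Ico_subset_Icc_self hr)))).mono hsub
      have h2 := h1.scomp r (hasDerivAt_neg r).hasDerivWithinAt hmaps
      simpa [Function.comp_def] using h2.mono_of_mem_nhdsWithin (Icc_mem_nhdsGE_of_mem hr)
    · simpa using bound (-r) (hsub (hmaps (Ico_subset_Icc_self hr)))

/-- A time-dependent vector field on `[0, ∞)`, continuous in time, locally Lipschitz in space
and of at most linear growth, both locally uniformly in time. -/
structure IsTameField (v : ℝ → E → E) : Prop where
  continuousOn : ∀ x, ContinuousOn (v · x) (Ici 0)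
  lipschitz : ∀ T R : ℝ, ∃ K : ℝ≥0, ∀ s ∈ Icc 0 T, LipschitzOnWith K (v s) (closedBall 0 R)
  growth : ∀ T : ℝ, ∃ A : ℝ, 0 ≤ A ∧ ∀ s ∈ Icc 0 T, ∀ x, ‖v s x‖ ≤ A * ‖x‖ + A

/-- The retraction of a normed space onto the ball of radius `R`. -/
noncomputable def ballRetraction (R : ℝ) (x : E) : E := (R / max R ‖x‖) • x

theorem ballRetraction_of_norm_le {R : ℝ} (hR : 0 < R) {x : E} (hx : ‖x‖ ≤ R) :
    ballRetraction R x = x := by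
  rw [ballRetraction, max_eq_left hx, div_self hR.ne', one_smul]

theorem norm_ballRetraction_le {R : ℝ} (hR : 0 < R) (x : E) : ‖ballRetraction R x‖ ≤ R := by
  rw [ballRetraction, norm_smul, Real.norm_of_nonneg (by positivity), div_mul_eq_mul_div,
    div_le_iff₀ (lt_max_of_lt_left hR)]
  gcongr
  exact le_max_right _ _

theorem norm_ballRetraction_le_norm {R : ℝ} (hR : 0 < R) (x : E) :
    ‖ballRetraction R x‖ ≤ ‖x‖ := by
  rw [ballRetraction, norm_smul, Real.norm_of_nonneg (by positivity)]
  refine mul_le_of_le_one_left (norm_nonneg _) ?_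
  rw [div_le_one (lt_max_of_lt_left hR)]
  exact le_max_left _ _

theorem lipschitzWith_ballRetraction {R : ℝ} (hR : 0 < R) :
    LipschitzWith 2 (ballRetraction R : E → E) := by
  refine LipschitzWith.of_dist_le_mul fun x y => ?_
  rw [dist_eq_norm, dist_eq_norm]
  set a := max R ‖x‖ with ha
  set b := max R ‖y‖ with hb
  have ha0 : 0 < a := lt_max_of_lt_left hR
  have hb0 : 0 < b := lt_max_of_lt_left hR
  have haR : R ≤ a := le_max_left _ _
  have hyb : ‖y‖ ≤ b := le_max_right _ _
  have hab : |b - a| ≤ ‖x - y‖ := by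
    rw [hb, ha]
    refine (abs_max_sub_max_le_max _ _ _ _).trans ?_
    rw [sub_self, abs_zero, max_eq_right (abs_nonneg _), norm_sub_rev]
    exact abs_norm_sub_norm_le y x
  have hsplit : ballRetraction R x - ballRetraction R y
      = (R / a) • (x - y) + (R / a * ((b - a) / b)) • y := by
    simp only [ballRetraction, ← ha, ← hb, smul_sub]
    have : R / a * ((b - a) / b) = R / a - R / b := by field_simp
    rw [this, sub_smul]
    abel
  have h1 : R / a ≤ 1 := (div_le_one ha0).2 haR
  have h0 : 0 ≤ R / a := by positivity
  rw [hsplit]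
  refine (norm_add_le _ _).trans ?_
  rw [norm_smul, norm_smul, Real.norm_eq_abs, Real.norm_eq_abs, abs_mul, abs_of_nonneg h0, abs_div,
    abs_of_pos hb0]
  have h3 : |b - a| / b * ‖y‖ ≤ ‖x - y‖ := by
    rw [div_mul_eq_mul_div, div_le_iff₀ hb0]
    gcongr
  have h4 : R / a * ‖x - y‖ ≤ ‖x - y‖ := mul_le_of_le_one_left (norm_nonneg _) h1
  have h5 : R / a * (|b - a| / b) * ‖y‖ ≤ ‖x - y‖ := by
    rw [mul_assoc]
    exact (mul_le_of_le_one_left (by positivity) h1).trans h3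
  simp only [NNReal.coe_ofNat]
  linarith

namespace IsTameField

variable {v : ℝ → E → E}

/-- A priori bound for solutions on `[0, T]`. -/
theorem norm_le_of_solution (hv : IsTameField v) (T : ℝ) : ∃ B : ℝ → ℝ, Monotone B ∧
    ∀ w : ℝ → E → E, (∀ A : ℝ, (∀ s ∈ Icc 0 T, ∀ x, ‖v s x‖ ≤ A * ‖x‖ + A) →
      ∀ s ∈ Icc 0 T, ∀ x, ‖w s x‖ ≤ A * ‖x‖ + A) →
    ∀ y : ℝ → E, (∀ s ∈ Icc 0 T, HasDerivWithinAt y (w s (y s)) (Icc 0 T) s) →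
      ∀ s ∈ Icc 0 T, ∀ t ∈ Icc 0 T, ‖y s‖ ≤ B ‖y t‖ := by
  obtain ⟨A, hA, hgr⟩ := hv.growth T
  have hmono : ∀ {δ₁ δ₂ r₁ r₂ : ℝ}, δ₁ ≤ δ₂ → 0 ≤ δ₂ → r₁ ≤ r₂ →
      gronwallBound δ₁ A A r₁ ≤ gronwallBound δ₂ A A r₂ := by
    intro δ₁ δ₂ r₁ r₂ h h0 hr
    refine le_trans ?_ (gronwallBound_mono h0 hA hA hr)
    unfold gronwallBound
    split_ifs
    · linarith
    · gcongr
  refine ⟨fun r => gronwallBound (max r 0) A A T, fun a b hab => ?_, ?_⟩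
  · exact hmono (max_le_max hab le_rfl) (le_max_right _ _) le_rfl
  · intro w hw y hy s hs t ht
    refine (norm_le_gronwallBound_abs_sub hy (fun r hr => hw A hgr r hr _) hs ht).trans ?_
    refine hmono (le_max_left _ _) (le_max_right _ _) ?_
    rw [abs_le]
    constructor <;> linarith [hs.1, hs.2, ht.1, ht.2]

/-- Solutions issued from a bounded set depend Lipschitz-continuously on the initial value. -/
theorem exists_dist_solution_le (hv : IsTameField v) (T R : ℝ) : ∃ L : ℝ, 0 ≤ L ∧
    ∀ y z : ℝ → E, (∀ s ∈ Icc 0 T, HasDerivWithinAt y (v s (y s)) (Icc 0 T) s) →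
      (∀ s ∈ Icc 0 T, HasDerivWithinAt z (v s (z s)) (Icc 0 T) s) →
      ∀ t ∈ Icc 0 T, ‖y t‖ ≤ R → ‖z t‖ ≤ R →
      ∀ s ∈ Icc 0 T, ‖y s - z s‖ ≤ L * ‖y t - z t‖ := by
  obtain ⟨B, hB, hbd⟩ := hv.norm_le_of_solution T
  obtain ⟨K, hK⟩ := hv.lipschitz T (B R)
  refine ⟨Real.exp (K * T), (Real.exp_pos _).le, fun y z hy hz t ht hyR hzR s hs => ?_⟩
  have hyB : ∀ r ∈ Icc 0 T, y r ∈ closedBall (0 : E) (B R) := fun r hr => by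
    simpa using (hbd v (fun _ h => h) y hy r hr t ht).trans (hB hyR)
  have hzB : ∀ r ∈ Icc 0 T, z r ∈ closedBall (0 : E) (B R) := fun r hr => by
    simpa using (hbd v (fun _ h => h) z hz r hr t ht).trans (hB hzR)
  have := norm_le_gronwallBound_abs_sub (y := y - z) (K := K) (ε := 0)
    (fun r hr => (hy r hr).sub (hz r hr))
    (fun r hr => by
      simpa [dist_eq_norm] using (hK r hr).dist_le_mul _ (hyB r hr) _ (hzB r hr)) hs ht
  rw [gronwallBound_ε0] at this
  refine this.trans ?_
  rw [mul_comm]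
  gcongr
  · rw [abs_le]
    constructor <;> linarith [hs.1, hs.2, ht.1, ht.2]
  · exact le_rfl

theorem solution_unique (hv : IsTameField v) {T t : ℝ} (ht : t ∈ Icc 0 T) {y z : ℝ → E}
    (hy : ∀ s ∈ Icc 0 T, HasDerivWithinAt y (v s (y s)) (Icc 0 T) s)
    (hz : ∀ s ∈ Icc 0 T, HasDerivWithinAt z (v s (z s)) (Icc 0 T) s)
    (h : y t = z t) {s : ℝ} (hs : s ∈ Icc 0 T) : y s = z s := by
  obtain ⟨L, -, hL⟩ := hv.exists_dist_solution_le T ‖y t‖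
  have := hL y z hy hz t ht le_rfl (by rw [h]) s hs
  rw [h, sub_self, norm_zero, mul_zero] at this
  exact sub_eq_zero.1 (norm_le_zero_iff.1 this)

variable [CompleteSpace E]

theorem exists_solution_Icc (hv : IsTameField v) {T t : ℝ} (ht : t ∈ Icc 0 T) (x : E) :
    ∃ y : ℝ → E, y t = x ∧ ∀ s ∈ Icc 0 T, HasDerivWithinAt y (v s (y s)) (Icc 0 T) s := by
  obtain ⟨B, hB, hbd⟩ := hv.norm_le_of_solution T
  set R : ℝ := max (B ‖x‖) 1 with hRdef
  have hR : 0 < R := lt_max_of_lt_right one_pos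
  have hT : 0 ≤ T := ht.1.trans ht.2
  obtain ⟨K, hK⟩ := hv.lipschitz T R
  obtain ⟨A, hA, hgr⟩ := hv.growth T
  have hmem : ∀ z : E, ballRetraction R z ∈ closedBall (0 : E) R := fun z => by
    simpa using norm_ballRetraction_le hR z
  let w : ℝ → E → E := fun s z => v s (ballRetraction R z)
  have hpl : IsPicardLindelof w (⟨t, ht⟩ : Icc 0 T) x
      ((A * R + A).toNNReal * T.toNNReal) 0 (A * R + A).toNNReal (K * 2) := by
    refine ⟨fun s hs => ?_, fun z _ => ?_, fun s hs z _ => ?_, ?_⟩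
    · exact ((hK s hs).comp (lipschitzWith_ballRetraction hR).lipschitzOnWith
        fun z _ => hmem z)
    · exact (hv.continuousOn _).mono Icc_subset_Ici_self
    · rw [Real.coe_toNNReal _ (by positivity)]
      refine (hgr s hs _).trans ?_
      gcongr
      exact norm_ballRetraction_le hR z
    · rw [NNReal.coe_mul, Real.coe_toNNReal T hT, NNReal.coe_zero, sub_zero]
      rw [sub_zero]
      refine mul_le_mul_of_nonneg_left ?_ (NNReal.coe_nonneg _)
      exact max_le (by simpa using ht.1) (by simpa using ht.2)
  obtain ⟨y, hyt, hy⟩ := hpl.exists_eq_forall_mem_Icc_hasDerivWithinAt₀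
  refine ⟨y, hyt, fun s hs => ?_⟩
  have hyR : ‖y s‖ ≤ R := by
    refine (hbd w (fun A' hA' r hr z => ?_) y hy s hs t ht).trans ?_
    · refine (hA' r hr _).trans ?_
      have hA'0 : 0 ≤ A' := by simpa using (norm_nonneg _).trans (hA' r hr 0)
      gcongr
      exact norm_ballRetraction_le_norm hR z
    · rw [show y t = x from hyt]
      exact le_max_left _ _
  have := hy s hs
  simpa only [w, ballRetraction_of_norm_le hR hyR] using this

theorem exists_solution (hv : IsTameField v) {t : ℝ} (ht : t ∈ Ici (0 : ℝ)) (x : E) :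
    ∃ y : ℝ → E, y t = x ∧ ∀ s ∈ Ici (0 : ℝ), HasDerivWithinAt y (v s (y s)) (Ici 0) s := by
  rw [mem_Ici] at ht
  have hex : ∀ n : ℕ, ∃ y : ℝ → E, y t = x ∧
      ∀ s ∈ Icc 0 (t + n), HasDerivWithinAt y (v s (y s)) (Icc 0 (t + n)) s := fun n =>
    hv.exists_solution_Icc ⟨ht, le_add_of_nonneg_right n.cast_nonneg⟩ x
  choose Y hYt hY using hex
  have hYeq : ∀ m n : ℕ, m ≤ n → ∀ s ∈ Icc 0 (t + m), Y m s = Y n s := by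
    intro m n hmn s hs
    have hsub : Icc 0 (t + m) ⊆ Icc 0 (t + n) :=
      Icc_subset_Icc_right (by gcongr)
    exact hv.solution_unique ⟨ht, le_add_of_nonneg_right m.cast_nonneg⟩ (hY m)
      (fun r hr => (hY n r (hsub hr)).mono hsub) ((hYt m).trans (hYt n).symm) hs
  have hYeq' : ∀ m n : ℕ, ∀ s ∈ Icc 0 (t + m), s ≤ t + n → Y m s = Y n s := by
    intro m n s hs hsn
    rcases le_total m n with h | h
    · exact hYeq m n h s hs
    · exact (hYeq n m h s ⟨hs.1, hsn⟩).symm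
  have hceil : ∀ s : ℝ, s ≤ t + (⌈s⌉₊ : ℝ) := fun s => (Nat.le_ceil s).trans (by linarith)
  refine ⟨fun s => Y ⌈s⌉₊ s, hYt _, fun s hs => ?_⟩
  rw [mem_Ici] at hs
  set n := ⌈s⌉₊ + 1
  have hsn : s < t + n := by
    have := hceil s
    push_cast [n]
    linarith
  have heq : ∀ r ∈ Icc 0 (t + n), Y ⌈r⌉₊ r = Y n r := fun r hr =>
    hYeq' _ _ r ⟨hr.1, hceil r⟩ hr.2
  have h1 : HasDerivWithinAt (Y n) (v s (Y n s)) (Ici 0) s := by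
    refine (hY n s ⟨hs, hsn.le⟩).mono_of_mem_nhdsWithin ?_
    rw [← Ici_inter_Iic]
    exact Filter.inter_mem self_mem_nhdsWithin (mem_nhdsWithin_of_mem_nhds (Iic_mem_nhds hsn))
  beta_reduce
  rw [heq s ⟨hs, hsn.le⟩]
  refine h1.congr_of_eventuallyEq ?_ (heq s ⟨hs, hsn.le⟩)
  have : Iic (t + n : ℝ) ∈ 𝓝[Ici 0] s := mem_nhdsWithin_of_mem_nhds (Iic_mem_nhds hsn)
  filter_upwards [this, self_mem_nhdsWithin] with r hr hr0 using heq r ⟨hr0, hr⟩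

/-- The flow of a tame field: `hv.flow s t x` is the position at time `s` of the
solution passing through `x` at time `t`. -/
noncomputable def flow (hv : IsTameField v) (s t : ℝ) (x : E) : E :=
  if ht : t ∈ Ici (0 : ℝ) then (hv.exists_solution ht x).choose s else x

theorem flow_self (hv : IsTameField v) {t : ℝ} (ht : t ∈ Ici (0 : ℝ)) (x : E) :
    hv.flow t t x = x := by
  rw [flow, dif_pos ht]
  exact (hv.exists_solution ht x).choose_spec.1

theorem hasDerivWithinAt_flow (hv : IsTameField v) {t : ℝ} (ht : t ∈ Ici (0 : ℝ)) (x : E) {s : ℝ}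
    (hs : s ∈ Ici (0 : ℝ)) :
    HasDerivWithinAt (fun r => hv.flow r t x) (v s (hv.flow s t x)) (Ici 0) s := by
  simp only [flow, dif_pos ht]
  exact (hv.exists_solution ht x).choose_spec.2 s hs

theorem hasDerivWithinAt_flow_Icc (hv : IsTameField v) {t : ℝ} (ht : t ∈ Ici (0 : ℝ)) (x : E)
    {T s : ℝ} (hs : s ∈ Icc 0 T) :
    HasDerivWithinAt (fun r => hv.flow r t x) (v s (hv.flow s t x)) (Icc 0 T) s :=
  (hv.hasDerivWithinAt_flow ht x hs.1).mono Icc_subset_Ici_self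

theorem eq_flow (hv : IsTameField v) {t : ℝ} (ht : t ∈ Ici (0 : ℝ)) {x : E} {y : ℝ → E}
    (hyt : y t = x) (hy : ∀ s ∈ Ici (0 : ℝ), HasDerivWithinAt y (v s (y s)) (Ici 0) s) {s : ℝ}
    (hs : s ∈ Ici (0 : ℝ)) : y s = hv.flow s t x :=
  hv.solution_unique (T := max s t) ⟨ht, le_max_right _ _⟩
    (fun r hr => (hy r hr.1).mono Icc_subset_Ici_self)
    (fun _ hr => hv.hasDerivWithinAt_flow_Icc ht x hr)
    (by rw [hyt, hv.flow_self ht]) ⟨hs, le_max_left _ _⟩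

theorem flow_flow (hv : IsTameField v) {t₁ t₂ t₃ : ℝ} (h₁ : t₁ ∈ Ici (0 : ℝ))
    (h₂ : t₂ ∈ Ici (0 : ℝ)) (h₃ : t₃ ∈ Ici (0 : ℝ)) (x : E) :
    hv.flow t₁ t₂ (hv.flow t₂ t₃ x) = hv.flow t₁ t₃ x :=
  (hv.eq_flow h₂ rfl (fun _ hs => hv.hasDerivWithinAt_flow h₃ x hs) h₁).symm

theorem exists_norm_flow_le (hv : IsTameField v) (T R : ℝ) : ∃ B : ℝ,
    ∀ s ∈ Icc 0 T, ∀ t ∈ Icc 0 T, ∀ x : E, ‖x‖ ≤ R → ‖hv.flow s t x‖ ≤ B := by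
  obtain ⟨B, hB, hbd⟩ := hv.norm_le_of_solution T
  refine ⟨B R, fun s hs t ht x hx => ?_⟩
  have := hbd v (fun _ h => h) _ (fun r hr => hv.hasDerivWithinAt_flow_Icc ht.1 x hr) s hs t ht
  rw [hv.flow_self ht.1] at this
  exact this.trans (hB hx)

theorem exists_dist_flow_le (hv : IsTameField v) (T R : ℝ) : ∃ L : ℝ, 0 ≤ L ∧
    ∀ s ∈ Icc 0 T, ∀ t ∈ Icc 0 T, ∀ x z : E, ‖x‖ ≤ R → ‖z‖ ≤ R →
      ‖hv.flow s t x - hv.flow s t z‖ ≤ L * ‖x - z‖ := by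
  obtain ⟨L, hL0, hL⟩ := hv.exists_dist_solution_le T R
  refine ⟨L, hL0, fun s hs t ht x z hx hz => ?_⟩
  have := hL _ _ (fun r hr => hv.hasDerivWithinAt_flow_Icc ht.1 x hr)
    (fun r hr => hv.hasDerivWithinAt_flow_Icc ht.1 z hr) t ht
  simp only [hv.flow_self ht.1] at this
  exact this hx hz s hs

theorem continuous_flow (hv : IsTameField v) {s t : ℝ} (hs : s ∈ Ici (0 : ℝ))
    (ht : t ∈ Ici (0 : ℝ)) : Continuous (hv.flow s t) := by
  refine continuous_iff_continuousAt.2 fun x => ?_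
  obtain ⟨L, -, hL⟩ := hv.exists_dist_flow_le (max s t) (‖x‖ + 1)
  refine ContinuousOn.continuousAt (s := ball x 1) ?_ (ball_mem_nhds x one_pos)
  have hmem : ∀ z ∈ ball x 1, ‖z‖ ≤ ‖x‖ + 1 := fun z hz => by
    have := norm_le_norm_add_norm_sub' z x
    rw [mem_ball, dist_eq_norm] at hz
    linarith
  refine (LipschitzOnWith.of_dist_le_mul (K := L.toNNReal) fun y hy z hz => ?_).continuousOn
  rw [dist_eq_norm, dist_eq_norm]
  refine (hL s ⟨hs, le_max_left _ _⟩ t ⟨ht, le_max_right _ _⟩ y z (hmem y hy) (hmem z hz)).trans ?_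
  gcongr
  exact Real.le_coe_toNNReal L

/-- The flow is continuous in the initial time. -/
theorem continuousOn_flow_right (hv : IsTameField v) {t : ℝ} (ht : t ∈ Ici (0 : ℝ)) (x : E) :
    ContinuousOn (fun s => hv.flow t s x) (Ici 0) := by
  intro s₀ hs₀
  have hcont : ContinuousWithinAt (fun s => hv.flow s s₀ x) (Ici 0) s₀ :=
    (hv.hasDerivWithinAt_flow hs₀ x hs₀).continuousWithinAt
  obtain ⟨B, hB⟩ := hv.exists_norm_flow_le (max t (s₀ + 1)) ‖x‖
  obtain ⟨L, hL0, hL⟩ := hv.exists_dist_flow_le (max t (s₀ + 1)) (max B ‖x‖)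
  rw [ContinuousWithinAt, tendsto_iff_norm_sub_tendsto_zero] at hcont ⊢
  simp only [hv.flow_self hs₀] at hcont
  have h0 := hcont.const_mul L
  rw [mul_zero] at h0
  refine squeeze_zero' (Filter.Eventually.of_forall fun _ => norm_nonneg _) ?_ h0
  have hlt : Iic (s₀ + 1) ∈ 𝓝[Ici 0] s₀ :=
    mem_nhdsWithin_of_mem_nhds (Iic_mem_nhds (by linarith))
  filter_upwards [hlt, self_mem_nhdsWithin] with s hs hs0
  have hsT : s ∈ Icc 0 (max t (s₀ + 1)) := ⟨hs0, le_max_of_le_right hs⟩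
  have htT : t ∈ Icc 0 (max t (s₀ + 1)) := ⟨ht, le_max_left _ _⟩
  have hs₀T : s₀ ∈ Icc 0 (max t (s₀ + 1)) := ⟨hs₀, le_max_of_le_right (by linarith)⟩
  rw [← hv.flow_flow ht hs0 hs₀ x, norm_sub_rev _ x, norm_sub_rev]
  have := hL t htT s hsT (hv.flow s s₀ x) x
    ((hB s hsT s₀ hs₀T x le_rfl).trans (le_max_left _ _)) (le_max_right _ _)
  rwa [norm_sub_rev _ x] at this

end IsTameField

end Flow

section Pinched

variable {E : Type*} [NormedAddCommGroup E] [InnerProductSpace ℝ E]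

open scoped RealInnerProductSpace

/-- `V` has gradient `p` and Hessian between `c > 0` and `C`, in the sense that `V` is squeezed
between two tangent quadratics at every point. -/
structure IsPinchedPotential (V : E → ℝ) (p : E → E) (c C : ℝ) : Prop where
  pos : 0 < c
  le : c ≤ C
  lower : ∀ x y, V x + ⟪p x, y - x⟫ + c / 2 * ‖y - x‖ ^ 2 ≤ V y
  upper : ∀ x y, V y ≤ V x + ⟪p x, y - x⟫ + C / 2 * ‖y - x‖ ^ 2

namespace IsPinchedPotential

variable {V : E → ℝ} {p : E → E} {c C : ℝ}

theorem tangent_le (h : IsPinchedPotential V p c C) (x y : E) : V x + ⟪p x, y - x⟫ ≤ V y := by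
  have := h.lower x y
  have h2 : 0 ≤ c / 2 * ‖y - x‖ ^ 2 := mul_nonneg (by linarith [h.pos]) (by positivity)
  linarith

theorem hasGradientAt [CompleteSpace E] (h : IsPinchedPotential V p c C) (x : E) :
    HasGradientAt V (p x) x := by
  rw [hasGradientAt_iff_isLittleO]
  have hb : (fun y => V y - V x - ⟪p x, y - x⟫) =O[nhds x] fun y => ‖y - x‖ ^ 2 := by
    refine Asymptotics.IsBigO.of_bound (C / 2) (Filter.Eventually.of_forall fun y => ?_)
    have h1 := h.tangent_le x y
    have h2 := h.upper x y
    rw [Real.norm_of_nonneg (by linarith), Real.norm_of_nonneg (by positivity)]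
    linarith
  refine hb.trans_isLittleO ?_
  have := Asymptotics.isLittleO_pow_sub_sub (E' := E) x one_lt_two
  simpa using this

theorem inner_sub_nonneg (h : IsPinchedPotential V p c C) (x y : E) :
    0 ≤ ⟪p x - p y, x - y⟫ := by
  have h1 := h.tangent_le x y
  have h2 := h.tangent_le y x
  rw [← neg_sub x y, inner_neg_right] at h1
  rw [inner_sub_left]
  linarith

theorem norm_sub_le (h : IsPinchedPotential V p c C) (x y : E) :
    ‖p x - p y‖ ≤ 2 * C * ‖x - y‖ := by
  have hC : 0 < C := h.pos.trans_le h.le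
  have key : ∀ w, ⟪p x - p y, w⟫ ≤ C / 2 * ‖x - y + w‖ ^ 2 := by
    intro w
    have h1 := h.upper y (x + w)
    have h2 := h.tangent_le x (x + w)
    have h3 := h.tangent_le y x
    rw [show x + w - y = x - y + w by abel, inner_add_right] at h1
    rw [add_sub_cancel_left] at h2
    rw [inner_sub_left]
    linarith
  rcases eq_or_ne (p x - p y) 0 with h0 | h0
  · rw [h0, norm_zero]; positivity
  rcases eq_or_ne x y with rfl | hxy
  · simp
  have hD : 0 < ‖p x - p y‖ := norm_pos_iff.2 h0
  have hδ : 0 < ‖x - y‖ := norm_pos_iff.2 (sub_ne_zero.2 hxy)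
  have h1 := key ((‖x - y‖ / ‖p x - p y‖) • (p x - p y))
  have h2 : ‖x - y + (‖x - y‖ / ‖p x - p y‖) • (p x - p y)‖ ≤ 2 * ‖x - y‖ := by
    refine (norm_add_le _ _).trans ?_
    rw [norm_smul, Real.norm_of_nonneg (by positivity), div_mul_cancel₀ _ hD.ne']
    linarith
  have h3 : ‖x - y + (‖x - y‖ / ‖p x - p y‖) • (p x - p y)‖ ^ 2 ≤ (2 * ‖x - y‖) ^ 2 := by
    gcongr
  rw [real_inner_smul_right, real_inner_self_eq_norm_sq] at h1
  have h4 : ‖x - y‖ / ‖p x - p y‖ * ‖p x - p y‖ ^ 2 = ‖x - y‖ * ‖p x - p y‖ := by field_simp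
  rw [h4] at h1
  have h5 : ‖x - y‖ * ‖p x - p y‖ ≤ ‖x - y‖ * (2 * C * ‖x - y‖) := by nlinarith
  exact le_of_mul_le_mul_left h5 hδ

theorem norm_le (h : IsPinchedPotential V p c C) (x : E) : ‖p x‖ ≤ ‖p 0‖ + 2 * C * ‖x‖ := by
  have h1 := h.norm_sub_le x 0
  rw [sub_zero] at h1
  have := norm_le_norm_add_norm_sub' (p x) (p 0)
  linarith

theorem exists_exp_neg_mul_le (h : IsPinchedPotential V p c C) :
    ∃ B, 0 ≤ B ∧ ∀ x, Real.exp (-V x) * (1 + ‖p x‖) ^ 2 ≤ B := by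
  have hc := h.pos
  have hC : 0 < C := h.pos.trans_le h.le
  set P := 1 + ‖p 0‖
  set K := Real.exp (‖p 0‖ ^ 2 / c - V 0)
  have hV : ∀ x, Real.exp (-V x) ≤ K * Real.exp (-(c / 4 * ‖x‖ ^ 2)) := by
    intro x
    rw [← Real.exp_add, Real.exp_le_exp]
    have h1 := h.lower 0 x
    rw [sub_zero] at h1
    have h2 : -(‖p 0‖ * ‖x‖) ≤ ⟪p 0, x⟫ := (abs_le.1 (abs_real_inner_le_norm (p 0) x)).1
    have h3 : ‖p 0‖ * ‖x‖ ≤ ‖p 0‖ ^ 2 / c + c / 4 * ‖x‖ ^ 2 := by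
      have : 0 ≤ (‖p 0‖ - c / 2 * ‖x‖) ^ 2 / c := by positivity
      have h4 : (‖p 0‖ - c / 2 * ‖x‖) ^ 2 / c
        = ‖p 0‖ ^ 2 / c + c / 4 * ‖x‖ ^ 2 - ‖p 0‖ * ‖x‖ := by field_simp; ring
      linarith
    linarith
  refine ⟨K * (2 * P ^ 2 + 8 * C ^ 2 * (4 / c)), by positivity, fun x => ?_⟩
  have h1 : (1 + ‖p x‖) ^ 2 ≤ 2 * P ^ 2 + 8 * C ^ 2 * ‖x‖ ^ 2 := by
    have : 1 + ‖p x‖ ≤ P + 2 * C * ‖x‖ := by have := h.norm_le x; simp only [P]; linarith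
    have h2 : (1 + ‖p x‖) ^ 2 ≤ (P + 2 * C * ‖x‖) ^ 2 := by gcongr
    nlinarith [sq_nonneg (P - 2 * C * ‖x‖)]
  have h2 : Real.exp (-(c / 4 * ‖x‖ ^ 2)) * ‖x‖ ^ 2 ≤ 4 / c := by
    rw [Real.exp_neg, inv_mul_le_iff₀ (Real.exp_pos _)]
    have := Real.add_one_le_exp (c / 4 * ‖x‖ ^ 2)
    have h3 : ‖x‖ ^ 2 = (c / 4 * ‖x‖ ^ 2) * (4 / c) := by field_simp
    rw [h3]
    gcongr
    rw [← h3]; linarith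
  have h3 : Real.exp (-(c / 4 * ‖x‖ ^ 2)) ≤ 1 := Real.exp_le_one_iff.2 (by simp; positivity)
  calc Real.exp (-V x) * (1 + ‖p x‖) ^ 2
      ≤ (K * Real.exp (-(c / 4 * ‖x‖ ^ 2))) * (2 * P ^ 2 + 8 * C ^ 2 * ‖x‖ ^ 2) := by
        gcongr; exact hV x
    _ = K * (2 * P ^ 2 * Real.exp (-(c / 4 * ‖x‖ ^ 2))
          + 8 * C ^ 2 * (Real.exp (-(c / 4 * ‖x‖ ^ 2)) * ‖x‖ ^ 2)) := by ring
    _ ≤ K * (2 * P ^ 2 * 1 + 8 * C ^ 2 * (4 / c)) := by gcongr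
    _ = _ := by ring

/-- The gradient `-e^{-V} ∇V` of the Gibbs weight `e^{-V}` is bounded and Lipschitz. -/
theorem exists_bounds (h : IsPinchedPotential V p c C) : ∃ M : NNReal,
    (∀ x, Real.exp (-V x) ≤ M) ∧ (∀ x, ‖Real.exp (-V x) • p x‖ ≤ M) ∧
    LipschitzWith M (fun x => -(Real.exp (-V x) • p x)) := by
  obtain ⟨B, hB0, hB⟩ := h.exists_exp_neg_mul_le
  have hC : 0 < C := h.pos.trans_le h.le
  have hg : ∀ x, 0 < Real.exp (-V x) := fun x => Real.exp_pos _
  have hB' : ∀ x, Real.exp (-V x) + 2 * (Real.exp (-V x) * ‖p x‖)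
      + Real.exp (-V x) * ‖p x‖ ^ 2 ≤ B := fun x => by linarith [hB x]
  have hn : ∀ x, 0 ≤ Real.exp (-V x) * ‖p x‖ := fun x => by positivity
  have hn2 : ∀ x, 0 ≤ Real.exp (-V x) * ‖p x‖ ^ 2 := fun x => by positivity
  have hG : ∀ x, ‖Real.exp (-V x) • p x‖ ≤ B := by
    intro x
    rw [norm_smul, Real.norm_of_nonneg (hg x).le]
    linarith [hB' x, hg x, hn x, hn2 x]
  have hL : ∀ x y, V y ≤ V x → ‖Real.exp (-V x) • p x - Real.exp (-V y) • p y‖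
      ≤ (3 + 3 * C) * B * ‖x - y‖ := by
    intro x y hxy
    rcases le_total 1 ‖x - y‖ with h1 | h1
    · have := norm_sub_le_of_le (hG x) (hG y)
      nlinarith [mul_nonneg hC.le hB0, mul_nonneg hB0 (norm_nonneg (x - y)),
        mul_nonneg (mul_nonneg hC.le hB0) (norm_nonneg (x - y))]
    · have e : Real.exp (-V x) • p x - Real.exp (-V y) • p y
          = Real.exp (-V x) • (p x - p y) - (Real.exp (-V y) - Real.exp (-V x)) • p y := by
        module
      have h2 : Real.exp (-V y) - Real.exp (-V x) ≤ Real.exp (-V y) * (V x - V y) := by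
        have e2 : Real.exp (-V x) = Real.exp (-V y) * Real.exp (-(V x - V y)) := by
          rw [← Real.exp_add]; ring_nf
        have := Real.add_one_le_exp (-(V x - V y))
        rw [e2]
        nlinarith [hg y]
      have h3 : 0 ≤ Real.exp (-V y) - Real.exp (-V x) := by
        rw [sub_nonneg, Real.exp_le_exp]; linarith
      have h4 : V x - V y ≤ (‖p y‖ + C / 2) * ‖x - y‖ := by
        have := h.upper y x
        have h5 := real_inner_le_norm (p y) (x - y)
        have h6 : C / 2 * ‖x - y‖ ^ 2 ≤ C / 2 * ‖x - y‖ := by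
          gcongr
          exact pow_le_of_le_one (norm_nonneg _) h1 two_ne_zero
        linarith
      rw [e]
      refine (_root_.norm_sub_le _ _).trans ?_
      rw [norm_smul, norm_smul, Real.norm_of_nonneg (hg x).le, Real.norm_of_nonneg h3]
      have h6 : Real.exp (-V x) * ‖p x - p y‖ ≤ B * (2 * C * ‖x - y‖) := by
        gcongr
        · linarith [hB' x, hg x, hn x, hn2 x]
        · exact h.norm_sub_le x y
      have h7 : (Real.exp (-V y) - Real.exp (-V x)) * ‖p y‖
          ≤ Real.exp (-V y) * ((‖p y‖ + C / 2) * ‖x - y‖) * ‖p y‖ := by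
        gcongr
        exact h2.trans (by gcongr)
      have h8 : Real.exp (-V y) * ((‖p y‖ + C / 2) * ‖x - y‖) * ‖p y‖
          = (Real.exp (-V y) * ‖p y‖ ^ 2 + C / 2 * (Real.exp (-V y) * ‖p y‖)) * ‖x - y‖ := by
        ring
      have h9 : (Real.exp (-V y) * ‖p y‖ ^ 2 + C / 2 * (Real.exp (-V y) * ‖p y‖)) * ‖x - y‖
          ≤ (B + C / 2 * B) * ‖x - y‖ := by
        gcongr
        · linarith [hB' y, hg y, hn y, hn2 y]
        · linarith [hB' y, hg y, hn y, hn2 y]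
      nlinarith [mul_nonneg hB0 (norm_nonneg (x - y)),
        mul_nonneg (mul_nonneg hC.le hB0) (norm_nonneg (x - y))]
  have hBM : B ≤ (3 + 3 * C) * B := by nlinarith
  refine ⟨NNReal.mk ((3 + 3 * C) * B) (by positivity), fun x => ?_, fun x => (hG x).trans hBM,
    LipschitzWith.of_dist_le_mul fun x y => ?_⟩
  · refine le_trans ?_ hBM
    linarith [hB' x, hg x, hn x, hn2 x]
  · rw [dist_neg_neg, dist_eq_norm, dist_eq_norm]
    rcases le_total (V y) (V x) with h1 | h1
    · exact hL x y h1
    · rw [norm_sub_rev, norm_sub_rev x y]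
      exact hL y x h1

theorem hasGradientAt_exp_neg [CompleteSpace E] (h : IsPinchedPotential V p c C) (x : E) :
    HasGradientAt (fun x => Real.exp (-V x)) (-(Real.exp (-V x) • p x)) x := by
  rw [hasGradientAt_iff_hasFDerivAt]
  refine (h.hasGradientAt x).hasFDerivAt.fun_neg.exp.congr_fderiv ?_
  rw [map_neg, map_smul, smul_neg]

end IsPinchedPotential

end Pinched

section Gaussian

variable {E : Type*} [NormedAddCommGroup E] [InnerProductSpace ℝ E]

open scoped RealInnerProductSpace

/-- The density of the standard Gaussian measure of a Euclidean space. -/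
noncomputable def gaussDensity (z : E) : ℝ :=
  (2 * Real.pi) ^ (-(Module.finrank ℝ E : ℝ) / 2) * Real.exp (-(1 / 2) * ‖z‖ ^ 2)

/-- The standard Gaussian measure of a Euclidean space. -/
noncomputable def gaussMeasure (E : Type*) [NormedAddCommGroup E] [InnerProductSpace ℝ E]
    [FiniteDimensional ℝ E] [MeasurableSpace E] [BorelSpace E] : Measure E :=
  (volume : Measure E).withDensity fun z => ENNReal.ofReal (gaussDensity z)

theorem gaussDensity_pos (z : E) : 0 < gaussDensity z := by
  unfold gaussDensity; positivity

theorem continuous_gaussDensity : Continuous (gaussDensity : E → ℝ) := by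
  unfold gaussDensity; fun_prop

theorem hasFDerivAt_gaussDensity (z : E) :
    HasFDerivAt gaussDensity (-(gaussDensity z) • innerSL ℝ z) z := by
  have h := (((hasStrictFDerivAt_norm_sq z).hasFDerivAt.const_mul (-(1 / 2 : ℝ))).exp).const_mul
    ((2 * Real.pi) ^ (-(Module.finrank ℝ E : ℝ) / 2))
  refine h.congr_fderiv ?_
  ext y
  simp [gaussDensity]
  ring

variable [FiniteDimensional ℝ E] [MeasurableSpace E] [BorelSpace E]

theorem integrable_exp_neg_mul_norm_sq {b : ℝ} (hb : 0 < b) :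
    Integrable (fun z : E => Real.exp (-b * ‖z‖ ^ 2)) := by
  by_contra h
  have h1 := GaussianFourier.integral_rexp_neg_mul_sq_norm (V := E) hb
  rw [integral_undef h] at h1
  have : 0 < (Real.pi / b) ^ (Module.finrank ℝ E / 2 : ℝ) := by positivity
  linarith

theorem integrable_gaussDensity : Integrable (gaussDensity : E → ℝ) :=
  (integrable_exp_neg_mul_norm_sq (by norm_num)).const_mul _

theorem integral_gaussDensity : ∫ z : E, gaussDensity z = 1 := by
  unfold gaussDensity
  rw [integral_const_mul, GaussianFourier.integral_rexp_neg_mul_sq_norm (by norm_num)]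
  have h : Real.pi / (1 / 2) = 2 * Real.pi := by ring
  rw [h, ← Real.rpow_add (by positivity)]
  rw [neg_div, neg_add_cancel, Real.rpow_zero]

instance : IsProbabilityMeasure (gaussMeasure E) := by
  constructor
  rw [gaussMeasure, withDensity_apply _ MeasurableSet.univ, Measure.restrict_univ,
    ← ofReal_integral_eq_lintegral_ofReal integrable_gaussDensity
      (Filter.Eventually.of_forall fun z => (gaussDensity_pos z).le), integral_gaussDensity,
    ENNReal.ofReal_one]

theorem integral_gaussMeasure {F : Type*} [NormedAddCommGroup F] [NormedSpace ℝ F] (f : E → F) :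
    ∫ z, f z ∂(gaussMeasure E) = ∫ z, gaussDensity z • f z := by
  rw [gaussMeasure, integral_withDensity_eq_integral_toReal_smul
    continuous_gaussDensity.measurable.ennreal_ofReal (by simp)]
  simp [ENNReal.toReal_ofReal, (gaussDensity_pos _).le]

theorem integrable_gaussMeasure_iff {F : Type*} [NormedAddCommGroup F] [NormedSpace ℝ F]
    {f : E → F} :
    Integrable f (gaussMeasure E) ↔ Integrable (fun z => gaussDensity z • f z) := by
  rw [gaussMeasure, integrable_withDensity_iff_integrable_smul'
    continuous_gaussDensity.measurable.ennreal_ofReal (by simp)]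
  simp [ENNReal.toReal_ofReal, (gaussDensity_pos _).le]

theorem integrable_norm_sq_gaussMeasure :
    Integrable (fun z : E => ‖z‖ ^ 2) (gaussMeasure E) := by
  rw [integrable_gaussMeasure_iff]
  refine Integrable.mono' (g := fun z : E => (2 * Real.pi) ^ (-(Module.finrank ℝ E : ℝ) / 2) *
    (4 * Real.exp (-(1 / 4) * ‖z‖ ^ 2)))
    (((integrable_exp_neg_mul_norm_sq (by norm_num)).const_mul _).const_mul _)
    (continuous_gaussDensity.smul (by fun_prop)).aestronglyMeasurable
    (Filter.Eventually.of_forall fun z => ?_)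
  rw [norm_smul, Real.norm_of_nonneg (gaussDensity_pos z).le, Real.norm_of_nonneg (by positivity),
    gaussDensity, mul_assoc]
  refine mul_le_mul_of_nonneg_left ?_ (by positivity)
  have h : -(1 / 2) * ‖z‖ ^ 2 = -(1 / 4) * ‖z‖ ^ 2 + -(1 / 4 * ‖z‖ ^ 2) := by ring
  rw [h, Real.exp_add, mul_assoc, mul_comm (4 : ℝ)]
  refine mul_le_mul_of_nonneg_left ?_ (Real.exp_pos _).le
  rw [Real.exp_neg, inv_mul_le_iff₀ (Real.exp_pos _)]
  linarith [Real.add_one_le_exp (1 / 4 * ‖z‖ ^ 2)]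

theorem integrable_norm_gaussMeasure : Integrable (fun z : E => ‖z‖) (gaussMeasure E) := by
  refine ((integrable_const (1 : ℝ)).add integrable_norm_sq_gaussMeasure).mono'
    continuous_norm.aestronglyMeasurable (Filter.Eventually.of_forall fun z => ?_)
  simp only [norm_norm, Pi.add_apply]
  nlinarith [sq_nonneg (‖z‖ - 1)]

/-- Gaussian integration by parts. -/
theorem integral_inner_smul_gaussMeasure {F : Type*} [NormedAddCommGroup F] [NormedSpace ℝ F]
    {f : E → F} {f' : E → E →L[ℝ] F} (e : E) (hf : ∀ z, HasFDerivAt f (f' z) z)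
    (hfi : Integrable f (gaussMeasure E))
    (hzf : Integrable (fun z => ⟪z, e⟫ • f z) (gaussMeasure E))
    (hf'i : Integrable (fun z => f' z e) (gaussMeasure E)) :
    ∫ z, ⟪z, e⟫ • f z ∂(gaussMeasure E) = ∫ z, f' z e ∂(gaussMeasure E) := by
  rw [integrable_gaussMeasure_iff] at *
  have h := integral_bilinear_hasFDerivAt_right_eq_neg_left_of_integrable (μ := volume)
    (f := gaussDensity) (f' := fun z => -(gaussDensity z) • innerSL ℝ z) (g := f) (g' := f')
    (B := ContinuousLinearMap.lsmul ℝ ℝ) (v := e) (by simpa [mul_smul] using hzf.neg)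
    (by simpa using hf'i) (by simpa using hfi) (fun z _ => hasFDerivAt_gaussDensity z)
    (fun z _ => hf z)
  simp only [ContinuousLinearMap.lsmul_apply] at h
  rw [integral_gaussMeasure, integral_gaussMeasure, h, ← integral_neg]
  refine integral_congr_ae (Filter.Eventually.of_forall fun z => ?_)
  simp [mul_smul]

end Gaussian

section GaussAverage

open scoped RealInnerProductSpace NNReal

variable {E : Type*} [NormedAddCommGroup E] [InnerProductSpace ℝ E] [FiniteDimensional ℝ E]

/-- A positive bounded weight `g` with bounded and Lipschitz gradient `G`. -/
structure IsTameWeight (g : E → ℝ) (G : E → E) (M : ℝ≥0) : Prop where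
  pos : ∀ x, 0 < g x
  le : ∀ x, g x ≤ M
  hasGradientAt : ∀ x, HasGradientAt g (G x) x
  norm_le : ∀ x, ‖G x‖ ≤ M
  lipschitz : LipschitzWith M G

namespace IsTameWeight

variable {g : E → ℝ} {G : E → E} {M : ℝ≥0}

theorem continuous (h : IsTameWeight g G M) : Continuous g :=
  continuous_iff_continuousAt.2 fun x => (h.hasGradientAt x).continuousAt

theorem norm_weight_le (h : IsTameWeight g G M) (x : E) : ‖g x‖ ≤ M := by
  rw [Real.norm_of_nonneg (h.pos x).le]; exact h.le x

theorem lipschitzWith_weight (h : IsTameWeight g G M) : LipschitzWith M g := by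
  refine lipschitzWith_of_nnnorm_fderiv_le (𝕜 := ℝ)
    (fun x => (h.hasGradientAt x).differentiableAt) fun x => ?_
  rw [(h.hasGradientAt x).hasFDerivAt.fderiv, LinearIsometryEquiv.nnnorm_map]
  exact h.norm_le x

end IsTameWeight

theorem IsPinchedPotential.exists_isTameWeight {V : E → ℝ} {p : E → E} {c C : ℝ}
    (h : IsPinchedPotential V p c C) : ∃ M,
    IsTameWeight (fun x => Real.exp (-V x)) (fun x => -(Real.exp (-V x) • p x)) M := by
  obtain ⟨M, h1, h2, h3⟩ := h.exists_bounds
  exact ⟨M, fun x => Real.exp_pos _, h1, h.hasGradientAt_exp_neg, fun x => by simpa using h2 x, h3⟩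

variable [MeasurableSpace E] [BorelSpace E] {F : Type*} [NormedAddCommGroup F]

theorem integrable_comp_gaussMeasure {f : E → F} (hf : Continuous f) {M : ℝ}
    (hM : ∀ x, ‖f x‖ ≤ M) (r : ℝ) (x : E) :
    Integrable (fun z => f (x + r • z)) (gaussMeasure E) :=
  (integrable_const M).mono' (hf.comp (by fun_prop)).aestronglyMeasurable
    (Filter.Eventually.of_forall fun _ => hM _)

variable [NormedSpace ℝ F]

/-- The average of `f` against the Gaussian of mean `x` and variance `r ^ 2`. -/
noncomputable def gaussAverage (f : E → F) (r : ℝ) (x : E) : F :=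
  ∫ z, f (x + r • z) ∂(gaussMeasure E)

theorem continuous_gaussAverage {f : E → F} (hf : Continuous f) {M : ℝ} (hM : ∀ x, ‖f x‖ ≤ M) :
    Continuous (fun q : ℝ × E => gaussAverage f q.1 q.2) := by
  refine continuous_of_dominated (bound := fun _ => M)
    (fun q => (hf.comp (by fun_prop)).aestronglyMeasurable)
    (fun q => Filter.Eventually.of_forall fun z => hM _) (integrable_const M)
    (Filter.Eventually.of_forall fun z => hf.comp (by fun_prop))

theorem norm_gaussAverage_le {f : E → F} {M : ℝ} (hM : ∀ x, ‖f x‖ ≤ M) (r : ℝ) (x : E) :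
    ‖gaussAverage f r x‖ ≤ M := by
  have := norm_integral_le_of_norm_le_const (μ := gaussMeasure E)
    (Filter.Eventually.of_forall fun z : E => hM (x + r • z))
  simpa [gaussAverage] using this

theorem lipschitzWith_gaussAverage {f : E → F} {M : ℝ} (hM : ∀ x, ‖f x‖ ≤ M) {L : ℝ≥0}
    (hL : LipschitzWith L f) (r : ℝ) : LipschitzWith L (gaussAverage f r) := by
  refine LipschitzWith.of_dist_le_mul fun x y => ?_
  rw [dist_eq_norm, gaussAverage, gaussAverage,
    ← integral_sub (integrable_comp_gaussMeasure hL.continuous hM r x)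
      (integrable_comp_gaussMeasure hL.continuous hM r y)]
  have := norm_integral_le_of_norm_le_const (μ := gaussMeasure E) (C := L * dist x y)
    (f := fun z => f (x + r • z) - f (y + r • z)) (Filter.Eventually.of_forall fun z => by
      rw [← dist_eq_norm]
      simpa using hL.dist_le_mul (x + r • z) (y + r • z))
  simpa using this

namespace IsTameWeight

variable {g : E → ℝ} {G : E → E} {M : ℝ≥0}

theorem gaussAverage_pos (h : IsTameWeight g G M) (r : ℝ) (x : E) : 0 < gaussAverage g r x := by
  rw [gaussAverage, integral_pos_iff_support_of_nonneg (fun z => (h.pos _).le)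
    (integrable_comp_gaussMeasure h.continuous h.norm_weight_le r x)]
  have : Function.support (fun z : E => g (x + r • z)) = univ := by
    ext z; simp [(h.pos (x + r • z)).ne']
  rw [this]; simp

theorem integrable_smul (h : IsTameWeight g G M) {q : E → F}
    (hq : Integrable q (gaussMeasure E)) (r : ℝ) (x : E) :
    Integrable (fun z => g (x + r • z) • q z) (gaussMeasure E) :=
  hq.bdd_smul (M : ℝ) (h.continuous.comp (by fun_prop)).aestronglyMeasurable
    (Filter.Eventually.of_forall fun _ => h.norm_weight_le _)

theorem hasFDerivAt_integral_smul (h : IsTameWeight g G M) {q : E → F} (hqc : Continuous q)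
    (hq : Integrable q (gaussMeasure E)) (r : ℝ) (x : E) :
    HasFDerivAt (fun x => ∫ z, g (x + r • z) • q z ∂(gaussMeasure E))
      (∫ z, (innerSL ℝ (G (x + r • z))).smulRight (q z) ∂(gaussMeasure E)) x := by
  refine hasFDerivAt_integral_of_dominated_of_fderiv_le (𝕜 := ℝ) (s := univ)
    (F' := fun x z => (innerSL ℝ (G (x + r • z))).smulRight (q z))
    (bound := fun z => M * ‖q z‖) Filter.univ_mem
    (Filter.Eventually.of_forall fun y => (h.integrable_smul hq r y).aestronglyMeasurable)
    (h.integrable_smul hq r x) ?_ ?_ (hq.norm.const_mul _) ?_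
  · have : SecondCountableTopologyEither E (E →L[ℝ] F) := secondCountableTopologyEither_of_left _ _
    refine Continuous.aestronglyMeasurable ?_
    have h1 : Continuous fun z => innerSL ℝ (G (x + r • z)) :=
      (innerSL ℝ).continuous.comp (h.lipschitz.continuous.comp (by fun_prop))
    exact (ContinuousLinearMap.smulRightL ℝ E F).continuous₂.comp (h1.prodMk hqc)
  · refine Filter.Eventually.of_forall fun z y _ => ?_
    rw [ContinuousLinearMap.norm_smulRight_apply, innerSL_apply_norm]
    gcongr
    exact h.norm_le _
  · refine Filter.Eventually.of_forall fun z y _ => ?_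
    have h1 := (h.hasGradientAt (y + r • z)).hasFDerivAt.comp y
      ((hasFDerivAt_id y).add_const (r • z))
    exact h1.smul_const (q z)

theorem hasDerivAt_integral_left (h : IsTameWeight g G M) (r : ℝ) (x : E) :
    HasDerivAt (fun r => gaussAverage g r x)
      (∫ z, ⟪G (x + r • z), z⟫ ∂(gaussMeasure E)) r := by
  refine (hasDerivAt_integral_of_dominated_loc_of_deriv_le (s := univ)
    (F := fun r z => g (x + r • z)) (F' := fun r z => ⟪G (x + r • z), z⟫)
    (bound := fun z => M * ‖z‖) Filter.univ_mem
    (Filter.Eventually.of_forall fun r => (h.continuous.comp (by fun_prop)).aestronglyMeasurable)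
    (integrable_comp_gaussMeasure h.continuous h.norm_weight_le r x) ?_ ?_
    (integrable_norm_gaussMeasure.const_mul _) ?_).2
  · exact ((h.lipschitz.continuous.comp (by fun_prop)).inner continuous_id).aestronglyMeasurable
  · refine Filter.Eventually.of_forall fun z y _ => (norm_inner_le_norm _ _).trans ?_
    gcongr
    exact h.norm_le _
  · refine Filter.Eventually.of_forall fun z y _ => ?_
    have h1 := (h.hasGradientAt (x + y • z)).hasFDerivAt.comp_hasDerivAt y
      (((hasDerivAt_id y).smul_const z).const_add x)
    exact h1.congr_deriv (by simp)

theorem hasGradientAt_gaussAverage (h : IsTameWeight g G M) (r : ℝ) (x : E) :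
    HasGradientAt (gaussAverage g r) (gaussAverage G r x) x := by
  have h1 := h.hasFDerivAt_integral_smul (q := fun _ => (1 : ℝ)) continuous_const
    (integrable_const _) r x
  simp only [smul_eq_mul, mul_one] at h1
  rw [hasGradientAt_iff_hasFDerivAt]
  refine h1.congr_fderiv ?_
  have h2 : ∀ z, (innerSL ℝ (G (x + r • z))).smulRight (1 : ℝ) = innerSL ℝ (G (x + r • z)) := by
    intro z; ext; simp
  simp_rw [h2]
  rw [ContinuousLinearMap.integral_comp_comm (innerSL ℝ)
    (integrable_comp_gaussMeasure h.lipschitz.continuous h.norm_le r x)]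
  rfl

theorem integrable_id_gaussMeasure : Integrable (fun z : E => z) (gaussMeasure E) :=
  integrable_norm_gaussMeasure.mono' continuous_id.aestronglyMeasurable
    (Filter.Eventually.of_forall fun _ => le_rfl)

theorem integral_smul_self_eq (h : IsTameWeight g G M) (r : ℝ) (x : E) :
    ∫ z, g (x + r • z) • z ∂(gaussMeasure E) = r • gaussAverage G r x := by
  refine ext_inner_left ℝ fun e => ?_
  rw [gaussAverage, inner_smul_right, ← integral_inner (h.integrable_smul
    integrable_id_gaussMeasure r x), ← integral_inner (integrable_comp_gaussMeasure
    h.lipschitz.continuous h.norm_le r x), ← integral_const_mul]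
  have hd : ∀ z, HasFDerivAt (fun z => g (x + r • z)) (r • innerSL ℝ (G (x + r • z))) z := by
    intro z
    have h1 := (h.hasGradientAt (x + r • z)).hasFDerivAt.comp z
      (((hasFDerivAt_id z).const_smul r).const_add x)
    refine h1.congr_fderiv ?_
    ext; simp
  have h1 : Integrable (fun z => g (x + r • z) • ⟪z, e⟫) (gaussMeasure E) :=
    h.integrable_smul (integrable_id_gaussMeasure.inner_const e) r x
  have := integral_inner_smul_gaussMeasure e hd
    (integrable_comp_gaussMeasure h.continuous h.norm_weight_le r x)
    (by simpa [mul_comm] using h1)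
    (by simpa using ((integrable_comp_gaussMeasure h.lipschitz.continuous h.norm_le r
      x).inner_const e).const_mul r)
  simpa [inner_smul_right, real_inner_comm, mul_comm] using this

theorem hasFDerivAt_gaussAverage_gradient (h : IsTameWeight g G M) {r : ℝ} (hr : r ≠ 0) (x : E) :
    HasFDerivAt (gaussAverage G r) (r⁻¹ • ∫ z, (innerSL ℝ (G (x + r • z))).smulRight z
      ∂(gaussMeasure E)) x := by
  have h1 := (h.hasFDerivAt_integral_smul continuous_id integrable_id_gaussMeasure r x).const_smul
    r⁻¹
  refine h1.congr_of_eventuallyEq (Filter.Eventually.of_forall fun y => ?_)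
  simp only [id, Pi.smul_apply]
  rw [h.integral_smul_self_eq r y, inv_smul_smul₀ hr]

theorem sum_inner_integral_smulRight (h : IsTameWeight g G M) {ι : Type*} [Fintype ι]
    (b : OrthonormalBasis ι ℝ E) (r : ℝ) (x : E) :
    ∑ i, ⟪b i, (∫ z, (innerSL ℝ (G (x + r • z))).smulRight z ∂(gaussMeasure E)) (b i)⟫ =
      ∫ z, ⟪G (x + r • z), z⟫ ∂(gaussMeasure E) := by
  have hi : Integrable (fun z => (innerSL ℝ (G (x + r • z))).smulRight z) (gaussMeasure E) := by
    refine (integrable_norm_gaussMeasure.const_mul (M : ℝ)).mono' ?_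
      (Filter.Eventually.of_forall fun z => ?_)
    · refine Continuous.aestronglyMeasurable ?_
      have h1 : Continuous fun z => innerSL ℝ (G (x + r • z)) :=
        (innerSL ℝ).continuous.comp (h.lipschitz.continuous.comp (by fun_prop))
      exact (ContinuousLinearMap.smulRightL ℝ E E).continuous₂.comp (h1.prodMk continuous_id)
    · rw [ContinuousLinearMap.norm_smulRight_apply, innerSL_apply_norm]
      gcongr
      exact h.norm_le _
  have h2 : ∀ i, ⟪b i, (∫ z, (innerSL ℝ (G (x + r • z))).smulRight z ∂(gaussMeasure E)) (b i)⟫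
      = ∫ z, ⟪G (x + r • z), b i⟫ * ⟪b i, z⟫ ∂(gaussMeasure E) := by
    intro i
    rw [ContinuousLinearMap.integral_apply hi, ← integral_inner (hi.apply_continuousLinearMap _)]
    simp [inner_smul_right]
  simp_rw [h2]
  rw [← integral_finsetSum]
  · simp_rw [OrthonormalBasis.sum_inner_mul_inner]
  · intro i _
    have := (hi.apply_continuousLinearMap (b i)).const_inner (𝕜 := ℝ) (b i)
    simpa [inner_smul_right] using this

end IsTameWeight

end GaussAverage

section Growth

open scoped RealInnerProductSpace

variable {E : Type*} [NormedAddCommGroup E] [InnerProductSpace ℝ E] [FiniteDimensional ℝ E]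
  [MeasurableSpace E] [BorelSpace E]

theorem IsTameWeight.integral_mul_norm_sq {g : E → ℝ} {G : E → E} {M : NNReal}
    (h : IsTameWeight g G M) (r : ℝ) (x : E) :
    ∫ z, g (x + r • z) * ‖z‖ ^ 2 ∂(gaussMeasure E) =
      Module.finrank ℝ E * gaussAverage g r x
        + r * ∫ z, ⟪G (x + r • z), z⟫ ∂(gaussMeasure E) := by
  set b := stdOrthonormalBasis ℝ E
  have hbn : ∀ i, ‖b i‖ = 1 := fun i => b.orthonormal.1 i
  have hle : ∀ i (z : E), |⟪z, b i⟫| ≤ ‖z‖ := fun i z => by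
    simpa [hbn] using abs_real_inner_le_norm z (b i)
  have hq1 : ∀ i, Integrable (fun z : E => ⟪z, b i⟫) (gaussMeasure E) := fun i =>
    IsTameWeight.integrable_id_gaussMeasure.inner_const (b i)
  have hq2 : ∀ i, Integrable (fun z : E => ⟪z, b i⟫ * ⟪z, b i⟫) (gaussMeasure E) := by
    refine fun i => integrable_norm_sq_gaussMeasure.mono' (by fun_prop)
      (Filter.Eventually.of_forall fun z => ?_)
    rw [norm_mul, Real.norm_eq_abs, sq]
    gcongr <;> exact hle i z
  have hG : ∀ i, Integrable (fun z : E => ⟪G (x + r • z), b i⟫ * ⟪z, b i⟫) (gaussMeasure E) := by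
    refine fun i => (integrable_norm_gaussMeasure.const_mul (M : ℝ)).mono' ?_
      (Filter.Eventually.of_forall fun z => ?_)
    · have := h.lipschitz.continuous
      exact Continuous.aestronglyMeasurable (by fun_prop)
    · rw [norm_mul, Real.norm_eq_abs, Real.norm_eq_abs]
      gcongr
      · exact (hle i _).trans (h.norm_le _)
      · exact hle i z
  have hgi := integrable_comp_gaussMeasure h.continuous h.norm_weight_le r x
  have key : ∀ i, ∫ z, ⟪z, b i⟫ * (g (x + r • z) * ⟪z, b i⟫) ∂(gaussMeasure E) =
      ∫ z, (r * (⟪G (x + r • z), b i⟫ * ⟪z, b i⟫) + g (x + r • z)) ∂(gaussMeasure E) := by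
    intro i
    have hd : ∀ z, HasFDerivAt (fun z => g (x + r • z) * ⟪z, b i⟫)
        (g (x + r • z) • innerSL ℝ (b i) + ⟪z, b i⟫ • r • innerSL ℝ (G (x + r • z))) z := by
      intro z
      have h1 := (h.hasGradientAt (x + r • z)).hasFDerivAt.comp z
        (((hasFDerivAt_id z).const_smul r).const_add x)
      have h2 : HasFDerivAt (fun z => ⟪z, b i⟫) (innerSL ℝ (b i)) z := by
        have := (innerSL ℝ (b i)).hasFDerivAt (x := z)
        simpa [real_inner_comm] using this
      refine (h1.mul h2).congr_fderiv ?_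
      ext; simp
    have e : ∀ z, (g (x + r • z) • innerSL ℝ (b i)
        + ⟪z, b i⟫ • r • innerSL ℝ (G (x + r • z))) (b i)
        = r * (⟪G (x + r • z), b i⟫ * ⟪z, b i⟫) + g (x + r • z) := by
      intro z
      simp [hbn]
      ring
    have := integral_inner_smul_gaussMeasure (b i) hd (h.integrable_smul (hq1 i) r x)
      ((h.integrable_smul (hq2 i) r x).congr (Filter.Eventually.of_forall fun z => by
        simp only [smul_eq_mul]; ring))
      ((((hG i).const_mul r).add hgi).congr (Filter.Eventually.of_forall fun z => (e z).symm))
    simp_rw [e] at this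
    exact this
  have hsum : ∀ z : E, ∑ i, ⟪z, b i⟫ * (g (x + r • z) * ⟪z, b i⟫) = g (x + r • z) * ‖z‖ ^ 2 := by
    intro z
    rw [← real_inner_self_eq_norm_sq, ← b.sum_inner_mul_inner z z, Finset.mul_sum]
    refine Finset.sum_congr rfl fun i _ => ?_
    rw [real_inner_comm z (b i)]
    ring
  simp_rw [← hsum]
  rw [integral_finsetSum]
  · simp_rw [key]
    have : ∀ i, ∫ z, (r * (⟪G (x + r • z), b i⟫ * ⟪z, b i⟫) + g (x + r • z)) ∂(gaussMeasure E)
        = r * (∫ z, ⟪G (x + r • z), b i⟫ * ⟪z, b i⟫ ∂(gaussMeasure E)) + gaussAverage g r x := by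
      intro i
      rw [integral_add ((hG i).const_mul r) hgi, integral_const_mul]
      rfl
    simp_rw [this]
    rw [Finset.sum_add_distrib, ← Finset.mul_sum, ← integral_finsetSum _ (fun i _ => hG i)]
    simp only [Finset.sum_const, Finset.card_univ, Fintype.card_fin, nsmul_eq_mul]
    rw [add_comm]
    congr 3
    ext z
    rw [← b.sum_inner_mul_inner]
    simp_rw [real_inner_comm z]
  · intro i _
    refine (h.integrable_smul (hq2 i) r x).congr (Filter.Eventually.of_forall fun z => by
        simp only [smul_eq_mul]; ring)

namespace IsPinchedPotential

variable {V : E → ℝ} {p : E → E} {c C : ℝ}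

/-- The logarithmic gradient of the regularized weight grows at most linearly. -/
theorem norm_gaussAverage_gradient_le (h : IsPinchedPotential V p c C) {r : ℝ} (hr : 0 ≤ r)
    (x : E) :
    ‖gaussAverage (fun x => -(Real.exp (-V x) • p x)) r x‖ ≤
      (‖p x‖ + 2 * C * r * (Module.finrank ℝ E + 1 / 2 + r * ‖p x‖)) *
        gaussAverage (fun x => Real.exp (-V x)) r x := by
  obtain ⟨M, hM⟩ := h.exists_isTameWeight
  have hC : 0 < C := h.pos.trans_le h.le
  set n : ℝ := (Module.finrank ℝ E : ℝ)
  set P := ‖p x‖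
  set g : E → ℝ := fun x => Real.exp (-V x) with hg
  set G : E → E := fun x => -(Real.exp (-V x) • p x) with hGdef
  set U := gaussAverage g r x with hU
  have hP : 0 ≤ P := norm_nonneg _
  have hn : 0 ≤ n := by positivity
  have hU0 : 0 < U := hM.gaussAverage_pos r x
  have i0 := integrable_comp_gaussMeasure hM.continuous hM.norm_weight_le r x
  have i1 : Integrable (fun z => g (x + r • z) * ‖z‖) (gaussMeasure E) :=
    hM.integrable_smul integrable_norm_gaussMeasure r x
  have i2 : Integrable (fun z => g (x + r • z) * ‖z‖ ^ 2) (gaussMeasure E) :=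
    hM.integrable_smul integrable_norm_sq_gaussMeasure r x
  set A1 := ∫ z, g (x + r • z) * ‖z‖ ∂(gaussMeasure E)
  set A2 := ∫ z, g (x + r • z) * ‖z‖ ^ 2 ∂(gaussMeasure E)
  have hA2 : A2 = n * U + r * ∫ z, ⟪G (x + r • z), z⟫ ∂(gaussMeasure E) :=
    hM.integral_mul_norm_sq r x
  have hlin : ∀ α β : ℝ, ∫ z, (α * (g (x + r • z) * ‖z‖ ^ 2) + β * g (x + r • z)) ∂(gaussMeasure E)
      = α * A2 + β * U := by
    intro α β
    rw [integral_add (i2.const_mul α) (i0.const_mul β), integral_const_mul, integral_const_mul]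
    rfl
  have hili : ∀ α β : ℝ, Integrable (fun z => α * (g (x + r • z) * ‖z‖ ^ 2) + β * g (x + r • z))
      (gaussMeasure E) := fun α β => (i2.const_mul α).add (i0.const_mul β)
  have hA2' : A2 ≤ (2 * n + (r * P) ^ 2) * U := by
    have h1 : r * ∫ z, ⟪G (x + r • z), z⟫ ∂(gaussMeasure E) ≤ 1 / 2 * A2 + (r * P) ^ 2 / 2 * U := by
      rw [← hlin, ← integral_const_mul]
      have hi : Integrable (fun z => ⟪G (x + r • z), z⟫) (gaussMeasure E) := by
        refine (integrable_norm_gaussMeasure.const_mul (M : ℝ)).mono' ?_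
          (Filter.Eventually.of_forall fun z => (norm_inner_le_norm _ _).trans ?_)
        · exact ((hM.lipschitz.continuous.comp (by fun_prop)).inner
            continuous_id).aestronglyMeasurable
        · gcongr
          exact hM.norm_le _
      refine integral_mono (hi.const_mul r) (hili _ _) fun z => ?_
      have h2 := h.inner_sub_nonneg (x + r • z) x
      rw [add_sub_cancel_left, inner_sub_left, real_inner_smul_right, real_inner_smul_right] at h2
      have h3 : -(P * ‖z‖) ≤ ⟪p x, z⟫ := (abs_le.1 (abs_real_inner_le_norm (p x) z)).1
      have h4 := mul_le_mul_of_nonneg_left h3 hr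
      have h5 : -(r * ⟪p (x + r • z), z⟫) ≤ 1 / 2 * ‖z‖ ^ 2 + (r * P) ^ 2 / 2 := by
        nlinarith [sq_nonneg (‖z‖ - r * P)]
      have h6 := mul_le_mul_of_nonneg_left h5 (hM.pos (x + r • z)).le
      simp only [hGdef, inner_neg_left, real_inner_smul_left]
      simp only [hg] at h6 ⊢
      linarith
    linarith
  have hA1 : A1 ≤ (n + 1 / 2 + r * P) * U := by
    have hκ : 0 < 1 + r * P := by positivity
    have h1 : A1 ≤ (1 / (2 * (1 + r * P))) * A2 + (1 + r * P) / 2 * U := by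
      rw [← hlin]
      refine integral_mono i1 (hili _ _) fun z => ?_
      have h2 : ‖z‖ ≤ 1 / (2 * (1 + r * P)) * ‖z‖ ^ 2 + (1 + r * P) / 2 := by
        have h3 : 1 / (2 * (1 + r * P)) * ‖z‖ ^ 2 + (1 + r * P) / 2 - ‖z‖
          = (‖z‖ - (1 + r * P)) ^ 2 / (2 * (1 + r * P)) := by field_simp; ring
        have : 0 ≤ (‖z‖ - (1 + r * P)) ^ 2 / (2 * (1 + r * P)) := by positivity
        linarith
      have h4 := mul_le_mul_of_nonneg_left h2 (hM.pos (x + r • z)).le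
      simp only
      linarith
    have h2 : (1 / (2 * (1 + r * P))) * A2
        ≤ (1 / (2 * (1 + r * P))) * ((2 * n + (r * P) ^ 2) * U) := by gcongr
    have h3 : (1 / (2 * (1 + r * P))) * ((2 * n + (r * P) ^ 2) * U) ≤ (n + r * P / 2) * U := by
      rw [← mul_assoc]
      gcongr
      rw [one_div, inv_mul_le_iff₀ (by positivity)]
      have : 0 ≤ r * P := by positivity
      nlinarith
    linarith
  have hN : ‖gaussAverage G r x‖ ≤ P * U + 2 * C * r * A1 := by
    have h1 : P * U + 2 * C * r * A1 = ∫ z, (P * g (x + r • z) + 2 * C * r * (g (x + r • z) * ‖z‖))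
        ∂(gaussMeasure E) := by
      rw [integral_add (i0.const_mul P) (i1.const_mul _), integral_const_mul, integral_const_mul]
      rfl
    rw [h1]
    refine norm_integral_le_of_norm_le ((i0.const_mul P).add (i1.const_mul _))
      (Filter.Eventually.of_forall fun z => ?_)
    simp only [hGdef, norm_neg, norm_smul, Real.norm_of_nonneg (Real.exp_pos _).le]
    have h2 : ‖p (x + r • z)‖ ≤ P + 2 * C * (r * ‖z‖) := by
      have h3 := h.norm_sub_le (x + r • z) x
      rw [add_sub_cancel_left, norm_smul, Real.norm_of_nonneg hr] at h3
      have := norm_le_norm_add_norm_sub' (p (x + r • z)) (p x)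
      linarith
    have h4 := mul_le_mul_of_nonneg_left h2 (hM.pos (x + r • z)).le
    linarith
  have := mul_le_mul_of_nonneg_left hA1 (by positivity : 0 ≤ 2 * C * r)
  linarith

end IsPinchedPotential

end Growth

section HeatField

open scoped RealInnerProductSpace NNReal

variable {E : Type*} [NormedAddCommGroup E] [InnerProductSpace ℝ E] [FiniteDimensional ℝ E]
  [MeasurableSpace E] [BorelSpace E]

/-- The weight at time `s`, namely the convolution of `e^{-V}` with the Gaussian of variance `s`. -/
noncomputable def heatWeight (V : E → ℝ) (s : ℝ) (x : E) : ℝ :=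
  gaussAverage (fun x => Real.exp (-V x)) (√s) x

/-- The gradient at time `s` of the weight `heatWeight V`, where `p` is the gradient of `V`. -/
noncomputable def heatGradient (V : E → ℝ) (p : E → E) (s : ℝ) (x : E) : E :=
  gaussAverage (fun x => -(Real.exp (-V x) • p x)) (√s) x

/-- Half the gradient of the potential `-log (heatWeight V s)`. -/
noncomputable def heatField (V : E → ℝ) (p : E → E) (s : ℝ) (x : E) : E :=
  (1 / 2 : ℝ) • -((heatWeight V s x)⁻¹ • heatGradient V p s x)

namespace IsPinchedPotential

variable {V : E → ℝ} {p : E → E} {c C : ℝ}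

theorem heatWeight_pos (h : IsPinchedPotential V p c C) (s : ℝ) (x : E) : 0 < heatWeight V s x := by
  obtain ⟨M, hM⟩ := h.exists_isTameWeight
  exact hM.gaussAverage_pos _ _

theorem continuous_heatWeight (h : IsPinchedPotential V p c C) :
    Continuous (fun q : ℝ × E => heatWeight V q.1 q.2) := by
  obtain ⟨M, hM⟩ := h.exists_isTameWeight
  exact (continuous_gaussAverage hM.continuous hM.norm_weight_le).comp
    ((Real.continuous_sqrt.comp continuous_fst).prodMk continuous_snd)

theorem continuous_heatGradient (h : IsPinchedPotential V p c C) :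
    Continuous (fun q : ℝ × E => heatGradient V p q.1 q.2) := by
  obtain ⟨M, hM⟩ := h.exists_isTameWeight
  exact (continuous_gaussAverage hM.lipschitz.continuous hM.norm_le).comp
    ((Real.continuous_sqrt.comp continuous_fst).prodMk continuous_snd)

theorem continuous_heatField (h : IsPinchedPotential V p c C) :
    Continuous (fun q : ℝ × E => heatField V p q.1 q.2) :=
  ((h.continuous_heatWeight.inv₀ fun q => (h.heatWeight_pos q.1 q.2).ne').smul
    h.continuous_heatGradient).neg.const_smul _

theorem hasGradientAt_neg_log_heatWeight (h : IsPinchedPotential V p c C) (s : ℝ) (x : E) :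
    HasGradientAt (fun x => -Real.log (heatWeight V s x))
      (-((heatWeight V s x)⁻¹ • heatGradient V p s x)) x := by
  obtain ⟨M, hM⟩ := h.exists_isTameWeight
  rw [hasGradientAt_iff_hasFDerivAt]
  refine ((hM.hasGradientAt_gaussAverage (√s) x).hasFDerivAt.log
    (hM.gaussAverage_pos _ _).ne').fun_neg.congr_fderiv ?_
  rw [map_neg, map_smul]
  rfl

theorem isTameField_heatField (h : IsPinchedPotential V p c C) : IsTameField (heatField V p) := by
  obtain ⟨M, hM⟩ := h.exists_isTameWeight
  have hC : 0 < C := h.pos.trans_le h.le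
  refine ⟨fun x => (h.continuous_heatField.comp
    (continuous_id.prodMk continuous_const)).continuousOn, fun T R => ?_, fun T => ?_⟩
  · obtain ⟨m, hm0, hm⟩ := (isCompact_Icc.prod (isCompact_closedBall 0 R)).exists_forall_le'
      (s := Icc 0 T ×ˢ Metric.closedBall (0 : E) R) h.continuous_heatWeight.continuousOn
      (fun q _ => h.heatWeight_pos q.1 q.2)
    refine ⟨NNReal.mk (1 / 2 * (m⁻¹ * M + m⁻¹ * m⁻¹ * M * M)) (by positivity), fun s hs =>
      LipschitzOnWith.of_dist_le_mul fun x hx y hy => ?_⟩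
    have hux := hm (s, x) ⟨hs, hx⟩
    have huy := hm (s, y) ⟨hs, hy⟩
    have hu : dist (heatWeight V s x) (heatWeight V s y) ≤ M * dist x y :=
      (lipschitzWith_gaussAverage hM.norm_weight_le hM.lipschitzWith_weight _).dist_le_mul x y
    have hn : dist (heatGradient V p s x) (heatGradient V p s y) ≤ M * dist x y :=
      (lipschitzWith_gaussAverage hM.norm_le hM.lipschitz _).dist_le_mul x y
    have hny : ‖heatGradient V p s y‖ ≤ M := norm_gaussAverage_le hM.norm_le _ _
    rw [heatField, heatField]
    simp only at hux huy
    set a := heatWeight V s x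
    set b := heatWeight V s y
    have ha : 0 < a := hm0.trans_le hux
    have hb : 0 < b := hm0.trans_le huy
    rw [dist_smul₀, dist_neg_neg, Real.norm_of_nonneg (by norm_num),
      NNReal.coe_mk, mul_assoc]
    gcongr
    rw [dist_eq_norm]
    have e : a⁻¹ • heatGradient V p s x - b⁻¹ • heatGradient V p s y
        = a⁻¹ • (heatGradient V p s x - heatGradient V p s y)
          + (a⁻¹ * b⁻¹ * (b - a)) • heatGradient V p s y := by
      have : a⁻¹ * b⁻¹ * (b - a) = a⁻¹ - b⁻¹ := by field_simp
      rw [this]; module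
    have hia : a⁻¹ ≤ m⁻¹ := inv_anti₀ hm0 hux
    have hib : b⁻¹ ≤ m⁻¹ := inv_anti₀ hm0 huy
    rw [e]
    refine (norm_add_le _ _).trans ?_
    rw [norm_smul, norm_smul, norm_mul, Real.norm_of_nonneg (by positivity),
      Real.norm_of_nonneg (by positivity), ← dist_eq_norm, ← dist_eq_norm, dist_comm b a]
    calc a⁻¹ * dist (heatGradient V p s x) (heatGradient V p s y)
          + a⁻¹ * b⁻¹ * dist a b * ‖heatGradient V p s y‖
        ≤ m⁻¹ * (M * dist x y) + m⁻¹ * m⁻¹ * (M * dist x y) * M := by gcongr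
      _ = _ := by ring
  · set n : ℝ := (Module.finrank ℝ E : ℝ)
    set K₁ := 1 / 2 * (1 + 2 * C * √T * √T) with hK₁
    set K₂ := C * √T * (n + 1 / 2) with hK₂
    have hn : 0 ≤ n := by positivity
    refine ⟨K₁ * ‖p 0‖ + K₁ * (2 * C) + K₂, by positivity, fun s hs x => ?_⟩
    have hr : √s ≤ √T := Real.sqrt_le_sqrt hs.2
    have h1 : ‖heatGradient V p s x‖ ≤ (‖p x‖ + 2 * C * √s * (n + 1 / 2 + √s * ‖p x‖)) *
        heatWeight V s x := h.norm_gaussAverage_gradient_le (Real.sqrt_nonneg s) x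
    have hU := h.heatWeight_pos s x
    rw [heatField, norm_smul, norm_neg, norm_smul, Real.norm_of_nonneg (by norm_num),
      Real.norm_of_nonneg (by positivity)]
    have h2 : (heatWeight V s x)⁻¹ * ‖heatGradient V p s x‖
        ≤ ‖p x‖ + 2 * C * √s * (n + 1 / 2 + √s * ‖p x‖) := by
      rw [inv_mul_le_iff₀ hU, mul_comm]; exact h1
    have h3 : ‖p x‖ + 2 * C * √s * (n + 1 / 2 + √s * ‖p x‖)
        ≤ ‖p x‖ + 2 * C * √T * (n + 1 / 2 + √T * ‖p x‖) := by gcongr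
    have h4 : 1 / 2 * (‖p x‖ + 2 * C * √T * (n + 1 / 2 + √T * ‖p x‖)) = K₁ * ‖p x‖ + K₂ := by
      rw [hK₁, hK₂]; ring
    have h5 : K₁ * ‖p x‖ ≤ K₁ * (‖p 0‖ + 2 * C * ‖x‖) := by
      gcongr
      exact h.norm_le x
    have h6 : 0 ≤ K₁ * ‖p 0‖ * ‖x‖ := by positivity
    have h7 : 0 ≤ K₂ * ‖x‖ := by positivity
    have h8 : 0 ≤ K₁ * (2 * C) := by positivity
    linarith

end IsPinchedPotential

end HeatField

section HeatEquation

open scoped RealInnerProductSpace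

variable {E : Type*} [NormedAddCommGroup E] [InnerProductSpace ℝ E] [FiniteDimensional ℝ E]
  [MeasurableSpace E] [BorelSpace E]

/-- The heat equation for `heatWeight`, in divergence form, with a bound on the time derivative. -/
theorem IsPinchedPotential.exists_heat_equation {V : E → ℝ} {p : E → E} {c C : ℝ}
    (h : IsPinchedPotential V p c C) {ι : Type*} [Fintype ι] (b : OrthonormalBasis ι ℝ E) :
    ∃ K : ℝ, 0 ≤ K ∧ ∀ s, 0 < s → ∀ x, ∃ D : E →L[ℝ] E, HasFDerivAt (heatGradient V p s) D x ∧
      HasDerivAt (fun s => heatWeight V s x) (1 / 2 * ∑ i, ⟪b i, D (b i)⟫) s ∧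
      |1 / 2 * ∑ i, ⟪b i, D (b i)⟫| ≤ K / √s := by
  obtain ⟨M, hM⟩ := h.exists_isTameWeight
  refine ⟨1 / 2 * ∫ z, M * ‖z‖ ∂(gaussMeasure E), by positivity, fun s hs x => ?_⟩
  have hr : 0 < √s := Real.sqrt_pos.2 hs
  refine ⟨_, hM.hasFDerivAt_gaussAverage_gradient hr.ne' x, ?_⟩
  have hsum := hM.sum_inner_integral_smulRight b (√s) x
  simp only [smul_apply, inner_smul_right, ← Finset.mul_sum, hsum]
  refine ⟨?_, ?_⟩
  · refine ((hM.hasDerivAt_integral_left (√s) x).comp s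
      (Real.hasDerivAt_sqrt hs.ne')).congr_deriv ?_
    field_simp
  · have hb : |∫ z, ⟪-(Real.exp (-V (x + √s • z)) • p (x + √s • z)), z⟫ ∂(gaussMeasure E)| ≤
        ∫ z, M * ‖z‖ ∂(gaussMeasure E) := by
      rw [← Real.norm_eq_abs]
      exact norm_integral_le_of_norm_le (integrable_norm_gaussMeasure.const_mul (M : ℝ))
        (Filter.Eventually.of_forall fun z => (norm_inner_le_norm _ _).trans
          (mul_le_mul_of_nonneg_right (hM.norm_le _) (norm_nonneg _)))
    rw [abs_mul, abs_mul, abs_of_pos (inv_pos.2 hr), abs_of_pos (by norm_num : (0:ℝ) < 1 / 2)]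
    rw [mul_div_assoc, inv_mul_eq_div]
    gcongr

end HeatEquation

section FlowRegularity

open Metric
open scoped NNReal Topology

namespace IsTameField

variable {E : Type*} [NormedAddCommGroup E] [NormedSpace ℝ E] [CompleteSpace E] {v : ℝ → E → E}

theorem exists_norm_flow_sub_self_le (hv : IsTameField v) (T R : ℝ) : ∃ A : ℝ, 0 ≤ A ∧
    ∀ s ∈ Icc 0 T, ∀ t ∈ Icc 0 T, ∀ x, ‖x‖ ≤ R → ‖hv.flow s t x - x‖ ≤ A * |s - t| := by
  obtain ⟨B, hB⟩ := hv.exists_norm_flow_le T R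
  obtain ⟨A, hA0, hA⟩ := hv.growth T
  refine ⟨A * |B| + A, by positivity, fun s hs t ht x hx => ?_⟩
  have := Convex.norm_image_sub_le_of_norm_hasDerivWithin_le (C := A * |B| + A)
    (fun u hu => hv.hasDerivWithinAt_flow_Icc (T := T) ht.1 x hu) (fun u hu => ?_)
    (convex_Icc 0 T) ht hs
  · rwa [hv.flow_self ht.1, Real.norm_eq_abs] at this
  · refine (hA u hu _).trans ?_
    gcongr
    exact (hB u hu t ht x hx).trans (le_abs_self _)

theorem exists_dist_flow_right_le (hv : IsTameField v) (T R : ℝ) : ∃ L : ℝ, 0 ≤ L ∧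
    ∀ t ∈ Icc 0 T, ∀ s ∈ Icc 0 T, ∀ s' ∈ Icc 0 T, ∀ x, ‖x‖ ≤ R →
      ‖hv.flow t s x - hv.flow t s' x‖ ≤ L * |s - s'| := by
  obtain ⟨B, hB⟩ := hv.exists_norm_flow_le T R
  obtain ⟨A, hA0, hA⟩ := hv.exists_norm_flow_sub_self_le T R
  obtain ⟨L, hL0, hL⟩ := hv.exists_dist_flow_le T (max B R)
  refine ⟨L * A, by positivity, fun t ht s hs s' hs' x hx => ?_⟩
  rw [← hv.flow_flow ht.1 hs'.1 hs.1]
  refine (hL t ht s' hs' _ _ ((hB s' hs' s hs x hx).trans (le_max_left _ _))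
    (hx.trans (le_max_right _ _))).trans ?_
  rw [mul_assoc, abs_sub_comm]
  gcongr
  exact hA s' hs' s hs x hx

theorem hasDerivAt_flow_right (hv : IsTameField v) {s : ℝ} (hs : 0 < s) (x : E) :
    HasDerivAt (fun s' => hv.flow s s' x) (-v s x) s := by
  obtain ⟨A, hA0, hA⟩ := hv.exists_norm_flow_sub_self_le (s + 1) ‖x‖
  obtain ⟨B, hB⟩ := hv.exists_norm_flow_le (s + 1) ‖x‖
  obtain ⟨K, hK⟩ := hv.lipschitz (s + 1) (max B ‖x‖)
  rw [hasDerivAt_iff_isLittleO, Asymptotics.isLittleO_iff]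
  intro ε hε
  have hc : ContinuousAt (v · x) s := (hv.continuousOn x).continuousAt (Ici_mem_nhds hs)
  obtain ⟨δ, hδ, hδv⟩ := Metric.continuousAt_iff.1 hc (ε / 2) (by positivity)
  have hδ' : 0 < min (min δ (ε / (2 * (K * A + 1)))) (min s 1) := by positivity
  filter_upwards [Metric.ball_mem_nhds s hδ'] with s' hs'
  rw [mem_ball, Real.dist_eq, lt_min_iff, lt_min_iff, lt_min_iff] at hs'
  obtain ⟨⟨h1, h2⟩, h3, h4⟩ := hs'
  have hs'T : s' ∈ Icc 0 (s + 1) := by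
    rw [abs_lt] at h3 h4; constructor <;> linarith
  have hsT : s ∈ Icc 0 (s + 1) := ⟨hs.le, by linarith⟩
  have hsub : uIcc s s' ⊆ Icc 0 (s + 1) := uIcc_subset_Icc hsT hs'T
  have key := Convex.norm_image_sub_le_of_norm_hasDerivWithin_le (C := ε)
    (f := fun u => hv.flow u s' x - u • v s x) (f' := fun u => v u (hv.flow u s' x) - v s x)
    (fun u hu => ((hv.hasDerivWithinAt_flow_Icc hs'T.1 x (hsub hu)).mono hsub).sub
      (by simpa using ((hasDerivAt_id u).smul_const (v s x)).hasDerivWithinAt))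
    (fun u hu => ?_) (convex_uIcc s s') (x := s') (y := s) right_mem_uIcc left_mem_uIcc
  · rw [hv.flow_self hs'T.1] at key
    rw [hv.flow_self hs.le, norm_sub_rev s' s]
    convert key using 2
    module
  · have huT := hsub hu
    have h5 : |u - s'| ≤ |s' - s| := by
      rw [← Real.dist_eq, ← Real.dist_eq]
      exact (Real.dist_le_of_mem_uIcc hu right_mem_uIcc).trans (dist_comm s s').le
    have h6 : |u - s| < δ := by
      refine lt_of_le_of_lt ?_ h1
      rw [← Real.dist_eq, ← Real.dist_eq]
      exact (Real.dist_le_of_mem_uIcc hu left_mem_uIcc).trans (dist_comm s s').le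
    have h7 : ‖v u x - v s x‖ ≤ ε / 2 := by
      rw [← dist_eq_norm]; exact (hδv (by rwa [Real.dist_eq])).le
    have h8 : ‖v u (hv.flow u s' x) - v u x‖ ≤ K * (A * |u - s'|) := by
      rw [← dist_eq_norm]
      refine ((hK u huT).dist_le_mul _ (mem_closedBall_zero_iff.2
        ((hB u huT s' hs'T x le_rfl).trans (le_max_left _ _))) _
        (mem_closedBall_zero_iff.2 (le_max_right _ _))).trans ?_
      gcongr
      rw [dist_eq_norm]
      exact hA u huT s' hs'T x le_rfl
    have h9 : K * (A * |u - s'|) ≤ ε / 2 := by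
      have : |u - s'| ≤ ε / (2 * (K * A + 1)) := h5.trans h2.le
      rw [le_div_iff₀ (by positivity)] at this
      have := abs_nonneg (u - s')
      nlinarith
    have : v u (hv.flow u s' x) - v s x
        = (v u (hv.flow u s' x) - v u x) + (v u x - v s x) := by abel
    rw [this]
    linarith [norm_add_le (v u (hv.flow u s' x) - v u x) (v u x - v s x)]

/-- Pull-backs of compactly supported Lipschitz functions along the flow are uniformly Lipschitz
and uniformly compactly supported. -/
theorem exists_lipschitzWith_comp_flow (hv : IsTameField v) {f : E → ℝ} {L : ℝ≥0}
    (hf : LipschitzWith L f) (hfc : HasCompactSupport f) (T : ℝ) : ∃ (R : ℝ) (K : ℝ≥0),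
    ∀ s ∈ Icc 0 T, ∀ t ∈ Icc 0 T, (∀ x, f (hv.flow t s x) ≠ 0 → ‖x‖ ≤ R) ∧
      LipschitzWith K (fun x => f (hv.flow t s x)) := by
  obtain ⟨R₀, hR₀⟩ := hfc.isBounded.exists_norm_le
  obtain ⟨B, hB⟩ := hv.exists_norm_flow_le T R₀
  obtain ⟨K, hK0, hK⟩ := hv.exists_dist_flow_le T (|B| + 1)
  have hsupp : ∀ s ∈ Icc 0 T, ∀ t ∈ Icc 0 T, ∀ x, f (hv.flow t s x) ≠ 0 → ‖x‖ ≤ |B| := by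
    intro s hs t ht x hx
    have h1 := hR₀ _ (subset_tsupport f hx)
    have h2 := hB s hs t ht _ h1
    rw [hv.flow_flow hs.1 ht.1 hs.1, hv.flow_self hs.1] at h2
    exact h2.trans (le_abs_self B)
  have hpos : 0 < |B| + 1 := by positivity
  have hlip : ∀ s ∈ Icc 0 T, ∀ t ∈ Icc 0 T,
      LipschitzOnWith (L * K.toNNReal) (fun x => f (hv.flow t s x)) (closedBall 0 (|B| + 1)) := by
    intro s hs t ht
    refine hf.comp_lipschitzOnWith (LipschitzOnWith.of_dist_le_mul fun x hx y hy => ?_)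
    rw [dist_eq_norm, dist_eq_norm, Real.coe_toNNReal _ hK0]
    exact hK t ht s hs x y (mem_closedBall_zero_iff.1 hx) (mem_closedBall_zero_iff.1 hy)
  refine ⟨|B|, L * K.toNNReal * 2, fun s hs t ht => ⟨hsupp s hs t ht, ?_⟩⟩
  have e : (fun x => f (hv.flow t s x))
      = (fun x => f (hv.flow t s x)) ∘ ballRetraction (|B| + 1) := by
    ext x
    simp only [Function.comp_apply]
    rcases le_or_gt ‖x‖ (|B| + 1) with hx | hx
    · rw [ballRetraction_of_norm_le hpos hx]
    · have h1 : f (hv.flow t s x) = 0 := by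
        by_contra h
        linarith [hsupp s hs t ht x h]
      have h2 : f (hv.flow t s (ballRetraction (|B| + 1) x)) = 0 := by
        by_contra h
        have h3 := hsupp s hs t ht _ h
        rw [ballRetraction, max_eq_right hx.le, norm_smul, norm_div, norm_norm,
          Real.norm_of_nonneg hpos.le, div_mul_cancel₀ _ (by linarith)] at h3
        linarith
      rw [h1, h2]
  rw [e, ← lipschitzOnWith_univ]
  exact (hlip s hs t ht).comp (lipschitzWith_ballRetraction hpos).lipschitzOnWith
    (fun x _ => mem_closedBall_zero_iff.2 (norm_ballRetraction_le hpos x))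

end IsTameField

end FlowRegularity

section Transport

open scoped RealInnerProductSpace NNReal Topology

variable {E : Type*} [NormedAddCommGroup E] [InnerProductSpace ℝ E] [FiniteDimensional ℝ E]
  [MeasurableSpace E] [BorelSpace E]

theorem measurable_fderiv_apply {ψ : E → ℝ} {w : E → E} (hw : Measurable w) :
    Measurable fun x => fderiv ℝ ψ x (w x) := by
  set b := stdOrthonormalBasis ℝ E
  have h : ∀ x, fderiv ℝ ψ x (w x) = ∑ i, ⟪b i, w x⟫ * fderiv ℝ ψ x (b i) := fun x => by
    conv_lhs => rw [← b.sum_repr' (w x), map_sum]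
    simp only [map_smul, smul_eq_mul]
  simp only [h]
  exact Finset.measurable_sum _ fun i _ =>
    (measurable_const.inner hw).mul (measurable_fderiv_apply_const ℝ ψ (b i))

theorem LipschitzWith.integrable_fderiv_apply {ψ : E → ℝ} {K : ℝ≥0} (hψ : LipschitzWith K ψ)
    (hψc : HasCompactSupport ψ) (v : E) : Integrable (fun x => fderiv ℝ ψ x v) := by
  obtain ⟨R, hR⟩ := hψc.isBounded.subset_closedBall 0
  refine (((integrableOn_const (C := (K * ‖v‖ : ℝ))
    (measure_closedBall_lt_top (x := (0 : E)) (r := R)).ne)).integrable_indicator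
    measurableSet_closedBall).mono' (measurable_fderiv_apply_const ℝ ψ v).aestronglyMeasurable
    (Filter.Eventually.of_forall fun x => ?_)
  by_cases hx : x ∈ Metric.closedBall (0 : E) R
  · rw [indicator_of_mem hx]
    exact (ContinuousLinearMap.le_opNorm _ _).trans
      (mul_le_mul_of_nonneg_right (norm_fderiv_le_of_lipschitz ℝ hψ) (norm_nonneg _))
  · have h0 : fderiv ℝ ψ x = 0 := by
      by_contra h0
      exact hx (hR (support_fderiv_subset ℝ h0))
    rw [indicator_of_notMem hx, h0]
    simp

theorem LipschitzWith.integral_fderiv_apply_mul {f ψ : E → ℝ} {L K : ℝ≥0}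
    (hf : LipschitzWith L f) (hψ : LipschitzWith K ψ) (hψc : HasCompactSupport ψ) (v : E) :
    ∫ x, fderiv ℝ f x v * ψ x = -∫ x, fderiv ℝ ψ x v * f x := by
  have h := hf.integral_lineDeriv_mul_eq (μ := volume) hψ hψc v
  rw [← integral_neg]
  refine Eq.trans (integral_congr_ae ?_) (h.trans (integral_congr_ae ?_))
  · filter_upwards [hf.ae_differentiableAt (μ := volume)] with x hx
    rw [hx.lineDeriv_eq_fderiv]
  · filter_upwards [hψ.ae_differentiableAt (μ := volume)] with x hx
    rw [hx.lineDeriv_eq_fderiv, map_neg, neg_mul]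

namespace IsPinchedPotential

variable {V : E → ℝ} {p : E → E} {c C : ℝ}

/-- The heat equation in the form of the continuity equation driven by `heatField`, tested against
a Lipschitz function. -/
theorem integral_continuity_equation (h : IsPinchedPotential V p c C) {ψ : E → ℝ} {K : ℝ≥0}
    (hψ : LipschitzWith K ψ) (hψc : HasCompactSupport ψ) {s : ℝ} (hs : 0 < s) :
    ∫ x, (fderiv ℝ ψ x (-heatField V p s x) * heatWeight V s x
      + ψ x * deriv (fun s => heatWeight V s x) s) = 0 := by
  obtain ⟨M, hM⟩ := h.exists_isTameWeight
  set b := stdOrthonormalBasis ℝ E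
  obtain ⟨B, -, hB⟩ := h.exists_heat_equation b
  have hN : LipschitzWith M (heatGradient V p s) :=
    lipschitzWith_gaussAverage hM.norm_le hM.lipschitz _
  have hNb : ∀ x, ‖heatGradient V p s x‖ ≤ M := norm_gaussAverage_le hM.norm_le _
  have hf : ∀ i, LipschitzWith M fun x => ⟪b i, heatGradient V p s x⟫ := fun i => by
    refine LipschitzWith.of_dist_le_mul fun x y => ?_
    rw [Real.dist_eq, ← inner_sub_right]
    refine (abs_real_inner_le_norm _ _).trans ?_
    rw [b.norm_eq_one, one_mul, ← dist_eq_norm]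
    exact hN.dist_le_mul x y
  have hd : ∀ i x, fderiv ℝ (fun x => ⟪b i, heatGradient V p s x⟫) x (b i)
      = ⟪b i, fderiv ℝ (heatGradient V p s) x (b i)⟫ := fun i x => by
    obtain ⟨D, hD, -⟩ := hB s hs x
    have := ((innerSL ℝ (b i)).hasFDerivAt.comp x hD).fderiv
    simp only [Function.comp_def, innerSL_apply_apply] at this
    rw [this, hD.fderiv]
    rfl
  have hi₁ : ∀ i, Integrable fun x => fderiv ℝ ψ x (b i) * ⟪b i, heatGradient V p s x⟫ := fun i =>
    (hψ.integrable_fderiv_apply hψc (b i)).mul_bdd (c := (M : ℝ))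
      (hf i).continuous.aestronglyMeasurable (Filter.Eventually.of_forall fun x =>
        (norm_inner_le_norm _ _).trans (by rw [b.norm_eq_one, one_mul]; exact hNb x))
  have hi₂ : ∀ i, Integrable fun x =>
      fderiv ℝ (fun x => ⟪b i, heatGradient V p s x⟫) x (b i) * ψ x := fun i =>
    (hψ.continuous.integrable_of_hasCompactSupport hψc).bdd_mul (c := (M : ℝ))
      (measurable_fderiv_apply_const ℝ _ _).aestronglyMeasurable
      (Filter.Eventually.of_forall fun x => (ContinuousLinearMap.le_opNorm _ _).trans (by
        rw [b.norm_eq_one, mul_one]; exact norm_fderiv_le_of_lipschitz ℝ (hf i)))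
  have hpt : ∀ x, fderiv ℝ ψ x (-heatField V p s x) * heatWeight V s x
      + ψ x * deriv (fun s => heatWeight V s x) s
      = ∑ i, 1 / 2 * (fderiv ℝ ψ x (b i) * ⟪b i, heatGradient V p s x⟫
        + fderiv ℝ (fun x => ⟪b i, heatGradient V p s x⟫) x (b i) * ψ x) := fun x => by
    obtain ⟨D, hD, hD', -⟩ := hB s hs x
    have h1 : fderiv ℝ ψ x (heatGradient V p s x)
        = ∑ i, fderiv ℝ ψ x (b i) * ⟪b i, heatGradient V p s x⟫ := by
      conv_lhs => rw [← b.sum_repr' (heatGradient V p s x), map_sum]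
      simp only [map_smul, smul_eq_mul, mul_comm]
    rw [hD'.deriv, ← Finset.mul_sum, Finset.sum_add_distrib, ← h1, heatField]
    simp only [hd, hD.fderiv, ← Finset.sum_mul, map_neg, map_smul, smul_eq_mul]
    have := (h.heatWeight_pos s x).ne'
    field_simp
  simp only [hpt]
  rw [integral_finsetSum _ fun i _ => by simpa using! ((hi₁ i).add (hi₂ i)).const_mul (1 / 2)]
  refine Finset.sum_eq_zero fun i _ => ?_
  rw [integral_const_mul, integral_add (hi₁ i) (hi₂ i),
    (hf i).integral_fderiv_apply_mul hψ hψc, add_neg_cancel, mul_zero]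

theorem hasDerivAt_integral_comp_flow (h : IsPinchedPotential V p c C) {f : E → ℝ} {L : ℝ≥0}
    (hf : LipschitzWith L f) (hfc : HasCompactSupport f) {t s : ℝ} (ht : 0 ≤ t) (hs : 0 < s) :
    HasDerivAt (fun s => ∫ x, f (h.isTameField_heatField.flow t s x) * heatWeight V s x) 0 s := by
  set hv := h.isTameField_heatField
  obtain ⟨M, hM⟩ := h.exists_isTameWeight
  set T := max t (s + 1)
  have hIoo : Ioo (s / 2) (s + 1) ⊆ Icc 0 T := fun r hr =>
    ⟨by linarith [hr.1], hr.2.le.trans (le_max_right _ _)⟩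
  have hnhds : Ioo (s / 2) (s + 1) ∈ 𝓝 s := Ioo_mem_nhds (by linarith) (by linarith)
  have htT : t ∈ Icc 0 T := ⟨ht, le_max_left _ _⟩
  have hsT : s ∈ Icc 0 T := hIoo (mem_of_mem_nhds hnhds)
  obtain ⟨R, K, hRK⟩ := hv.exists_lipschitzWith_comp_flow hf hfc T
  obtain ⟨A, hA0, hA⟩ := hv.exists_dist_flow_right_le T R
  obtain ⟨B, hB0, hB⟩ := h.exists_heat_equation (stdOrthonormalBasis ℝ E)
  obtain ⟨N, hN⟩ := hfc.exists_bound_of_continuous hf.continuous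
  have hN0 : 0 ≤ N := (norm_nonneg _).trans (hN 0)
  have hcont : ∀ r ∈ Ioo (s / 2) (s + 1),
      Continuous fun x => f (hv.flow t r x) * heatWeight V r x := fun r hr =>
    (hf.continuous.comp (hv.continuous_flow ht (hIoo hr).1)).mul
      (h.continuous_heatWeight.comp (by fun_prop : Continuous fun x : E => (r, x)))
  have hψc : HasCompactSupport fun x => f (hv.flow t s x) :=
    HasCompactSupport.of_support_subset_isCompact (isCompact_closedBall (0 : E) R)
      fun x hx => mem_closedBall_zero_iff.2 ((hRK s hsT t htT).1 x hx)
  have hU : ∀ x, ∀ r ∈ Ioo (s / 2) (s + 1), ∀ r' ∈ Ioo (s / 2) (s + 1),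
      ‖heatWeight V r x - heatWeight V r' x‖ ≤ B / √(s / 2) * ‖r - r'‖ := fun x r hr r' hr' => by
    refine Convex.norm_image_sub_le_of_norm_deriv_le (𝕜 := ℝ) (f := fun s => heatWeight V s x)
      (fun u hu => ?_) (fun u hu => ?_)
      (convex_Ioo _ _) hr' hr
    · obtain ⟨D, -, hD, -⟩ := hB u (by linarith [hu.1]) x
      exact hD.differentiableAt
    · obtain ⟨D, -, hD, hD'⟩ := hB u (by linarith [hu.1]) x
      rw [hD.deriv]
      refine hD'.trans ?_
      have := hu.1
      gcongr
  refine (hasDerivAt_integral_of_dominated_loc_of_lip hnhds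
    (F := fun s x => f (hv.flow t s x) * heatWeight V s x)
    (F' := fun x => fderiv ℝ (fun x => f (hv.flow t s x)) x (-heatField V p s x) *
      heatWeight V s x + f (hv.flow t s x) * deriv (fun s => heatWeight V s x) s)
    (bound := (Metric.closedBall (0 : E) R).indicator
      fun _ => L * A * M + N * (B / √(s / 2))) ?_ ?_ ?_ ?_ ?_ ?_).2.congr_deriv
    (h.integral_continuity_equation (hRK s hsT t htT).2 hψc hs)
  · filter_upwards [hnhds] with r hr using (hcont r hr).aestronglyMeasurable
  · exact (hcont s (mem_of_mem_nhds hnhds)).integrable_of_hasCompactSupport hψc.mul_right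
  · have hU' : Measurable fun x => heatWeight V s x :=
      (h.continuous_heatWeight.comp (by fun_prop : Continuous fun x : E => (s, x))).measurable
    have hw : Measurable fun x => -heatField V p s x :=
      (h.continuous_heatField.comp
        (by fun_prop : Continuous fun x : E => (s, x))).neg.measurable
    have hd : Measurable fun x => deriv (fun s => heatWeight V s x) s :=
      (measurable_deriv_with_param (f := fun x s => heatWeight V s x)
        (h.continuous_heatWeight.comp continuous_swap)).comp
        (measurable_id.prodMk measurable_const)
    have hf' : Measurable fun x => f (hv.flow t s x) :=
      (hf.continuous.comp (hv.continuous_flow ht hs.le)).measurable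
    exact (((measurable_fderiv_apply hw).mul hU').add (hf'.mul hd)).aestronglyMeasurable
  · refine Filter.Eventually.of_forall fun x => LipschitzOnWith.of_dist_le_mul fun r hr r' hr' => ?_
    by_cases hx : x ∈ Metric.closedBall (0 : E) R
    · rw [indicator_of_mem hx, dist_eq_norm, dist_eq_norm, Real.coe_nnabs,
        abs_of_nonneg (by positivity)]
      have e : f (hv.flow t r x) * heatWeight V r x - f (hv.flow t r' x) * heatWeight V r' x
          = (f (hv.flow t r x) - f (hv.flow t r' x)) * heatWeight V r x
            + f (hv.flow t r' x) * (heatWeight V r x - heatWeight V r' x) := by ring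
      rw [e]
      refine (norm_add_le _ _).trans ?_
      rw [norm_mul, norm_mul, add_mul]
      have h1 : ‖f (hv.flow t r x) - f (hv.flow t r' x)‖ ≤ L * (A * ‖r - r'‖) := by
        refine (hf.norm_sub_le _ _).trans ?_
        gcongr
        exact hA t htT r (hIoo hr) r' (hIoo hr') x (mem_closedBall_zero_iff.1 hx)
      have h2 : ‖heatWeight V r x‖ ≤ M := norm_gaussAverage_le hM.norm_weight_le _ _
      calc _ ≤ L * (A * ‖r - r'‖) * M + N * (B / √(s / 2) * ‖r - r'‖) := by
            gcongr
            · exact hN _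
            · exact hU x r hr r' hr'
        _ = _ := by ring
    · have h0 : ∀ r ∈ Ioo (s / 2) (s + 1), f (hv.flow t r x) = 0 := fun r hr => by
        by_contra h0
        exact hx (mem_closedBall_zero_iff.2 ((hRK r (hIoo hr) t htT).1 x h0))
      rw [h0 r hr, h0 r' hr', zero_mul, zero_mul, dist_self]
      positivity
  · exact (integrableOn_const
      (measure_closedBall_lt_top (x := (0 : E)) (r := R)).ne).integrable_indicator
      measurableSet_closedBall
  · filter_upwards [(hRK s hsT t htT).2.ae_differentiableAt (μ := volume)] with x hx
    obtain ⟨D, -, hD, -⟩ := hB s hs x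
    have hflow : HasDerivAt (fun r => f (hv.flow t r x))
        (fderiv ℝ (fun x => f (hv.flow t s x)) x (-heatField V p s x)) s := by
      have h1 := hx.hasFDerivAt
      nth_rewrite 2 [← hv.flow_self (mem_Ici.2 hs.le) x] at h1
      refine (h1.comp_hasDerivAt s (hv.hasDerivAt_flow_right hs x)).congr_of_eventuallyEq ?_
      filter_upwards [Ioi_mem_nhds hs] with r hr
      simp only [Function.comp_apply]
      rw [hv.flow_flow ht hs.le (mem_Ioi.1 hr).le]
    exact hflow.mul hD.differentiableAt.hasDerivAt

/-- The flow of `heatField` transports the weights `heatWeight` into each other. -/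
theorem integral_comp_flow_mul_heatWeight (h : IsPinchedPotential V p c C) {f : E → ℝ} {L : ℝ≥0}
    (hf : LipschitzWith L f) (hfc : HasCompactSupport f) {s t : ℝ} (hs : 0 ≤ s) (ht : 0 ≤ t) :
    ∫ x, f (h.isTameField_heatField.flow t s x) * heatWeight V s x = ∫ x, f x * heatWeight V t x := by
  set hv := h.isTameField_heatField
  obtain ⟨M, hM⟩ := h.exists_isTameWeight
  set T := max s t
  have htT : t ∈ Icc 0 T := ⟨ht, le_max_right _ _⟩
  have hsT : s ∈ Icc 0 T := ⟨hs, le_max_left _ _⟩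
  obtain ⟨R, K, hRK⟩ := hv.exists_lipschitzWith_comp_flow hf hfc T
  obtain ⟨N, hN⟩ := hfc.exists_bound_of_continuous hf.continuous
  have hcont : ContinuousOn (fun s => ∫ x, f (hv.flow t s x) * heatWeight V s x) (Icc 0 T) := by
    refine continuousOn_of_dominated (bound := (Metric.closedBall (0 : E) R).indicator
      fun _ => N * M) (fun r hr => ?_) (fun r hr => Filter.Eventually.of_forall fun x => ?_) ?_
      (Filter.Eventually.of_forall fun x => ?_)
    · exact ((hf.continuous.comp (hv.continuous_flow ht hr.1)).mul
        (h.continuous_heatWeight.comp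
          (by fun_prop : Continuous fun x : E => (r, x)))).aestronglyMeasurable
    · by_cases hx : x ∈ Metric.closedBall (0 : E) R
      · rw [indicator_of_mem hx, norm_mul]
        have h2 : ‖heatWeight V r x‖ ≤ M := norm_gaussAverage_le hM.norm_weight_le _ _
        have h3 := hN (hv.flow t r x)
        have h4 := (norm_nonneg _).trans h3
        gcongr
      · have h0 : f (hv.flow t r x) = 0 := by
          by_contra h0
          exact hx (mem_closedBall_zero_iff.2 ((hRK r hr t htT).1 x h0))
        rw [indicator_of_notMem hx, h0, zero_mul, norm_zero]
    · exact (integrableOn_const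
        (measure_closedBall_lt_top (x := (0 : E)) (r := R)).ne).integrable_indicator
        measurableSet_closedBall
    · exact (hf.continuous.comp_continuousOn
        ((hv.continuousOn_flow_right ht x).mono Icc_subset_Ici_self)).mul
        (h.continuous_heatWeight.comp
          (by fun_prop : Continuous fun r : ℝ => (r, x))).continuousOn
  have hderiv : ∀ r ∈ interior (Icc 0 T),
      HasDerivAt (fun s => ∫ x, f (hv.flow t s x) * heatWeight V s x) 0 r := fun r hr => by
    rw [interior_Icc] at hr
    exact h.hasDerivAt_integral_comp_flow hf hfc ht hr.1
  have hdiff : DifferentiableOn ℝ (fun s => ∫ x, f (hv.flow t s x) * heatWeight V s x)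
      (interior (Icc 0 T)) := fun r hr => (hderiv r hr).differentiableAt.differentiableWithinAt
  have hmono := monotoneOn_of_deriv_nonneg (convex_Icc 0 T) hcont hdiff
    fun r hr => (hderiv r hr).deriv.ge
  have hanti := antitoneOn_of_deriv_nonpos (convex_Icc 0 T) hcont hdiff
    fun r hr => (hderiv r hr).deriv.le
  have hst : ∫ x, f (hv.flow t s x) * heatWeight V s x
      = ∫ x, f (hv.flow t t x) * heatWeight V t x := by
    rcases le_total s t with hle | hle
    · exact le_antisymm (hmono hsT htT hle) (hanti hsT htT hle)
    · exact le_antisymm (hanti htT hsT hle) (hmono htT hsT hle)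
  simpa only [hv.flow_self (mem_Ici.2 ht)] using hst

end IsPinchedPotential

end Transport

section Pushforward

open scoped NNReal ENNReal Topology

theorem MeasureTheory.Measure.ext_of_forall_lintegral_lipschitz_eq {X : Type*} [MetricSpace X]
    [ProperSpace X] [MeasurableSpace X] [BorelSpace X] {μ ν : Measure X}
    [IsLocallyFiniteMeasure μ] [IsLocallyFiniteMeasure ν]
    (h : ∀ (f : X → ℝ≥0) (K : ℝ≥0), LipschitzWith K f → HasCompactSupport f →
      ∫⁻ x, f x ∂μ = ∫⁻ x, f x ∂ν) : μ = ν := by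
  have key : ∀ (μ ν : Measure X) [IsLocallyFiniteMeasure μ] [IsLocallyFiniteMeasure ν],
      (∀ (f : X → ℝ≥0) (K : ℝ≥0), LipschitzWith K f → HasCompactSupport f →
        ∫⁻ x, f x ∂μ = ∫⁻ x, f x ∂ν) → ∀ A : Set X, IsCompact A → μ A ≤ ν A := by
    intro μ ν _ _ h A hA
    refine ge_of_tendsto ((tendsto_measure_cthickening_of_isCompact (μ := ν) hA).mono_left
      nhdsWithin_le_nhds : Filter.Tendsto _ (𝓝[>] (0 : ℝ)) _) ?_
    filter_upwards [self_mem_nhdsWithin] with δ hδ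
    have hδ : 0 < δ := hδ
    have h0 : ∀ x ∉ Metric.cthickening δ A, thickenedIndicator hδ A x = 0 := fun x hx =>
      thickenedIndicator_zero hδ A fun hx' => hx (Metric.thickening_subset_cthickening δ A hx')
    calc μ A = ∫⁻ x, A.indicator 1 x ∂μ := (lintegral_indicator_one hA.measurableSet).symm
      _ ≤ ∫⁻ x, (thickenedIndicator hδ A x : ℝ≥0∞) ∂μ := by
        refine lintegral_mono fun x => ?_
        by_cases hx : x ∈ A
        · simp [hx, thickenedIndicator_one hδ A hx]
        · simp [hx]
      _ = ∫⁻ x, (thickenedIndicator hδ A x : ℝ≥0∞) ∂ν :=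
        h _ _ (lipschitzWith_thickenedIndicator hδ A)
          (HasCompactSupport.intro hA.cthickening h0)
      _ ≤ ∫⁻ x, (Metric.cthickening δ A).indicator 1 x ∂ν := by
        refine lintegral_mono fun x => ?_
        by_cases hx : x ∈ Metric.cthickening δ A
        · simpa [hx] using thickenedIndicator_le_one hδ A x
        · simp [hx, h0 x hx]
      _ = ν (Metric.cthickening δ A) :=
        lintegral_indicator_one Metric.isClosed_cthickening.measurableSet
  apply Measure.OuterRegular.ext_isOpen
  apply Measure.InnerRegularWRT.eq_of_innerRegularWRT_of_forall_eq Measure.Regular.innerRegular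
    Measure.Regular.innerRegular
  exact fun A hA => (key μ ν h A hA).antisymm
    (key ν μ (fun f K hf hfc => (h f K hf hfc).symm) A hA)

/-- The flow of a tame field between two times, as a homeomorphism. -/
noncomputable def IsTameField.flowHomeomorph {E : Type*} [NormedAddCommGroup E] [NormedSpace ℝ E]
    [CompleteSpace E] {v : ℝ → E → E} (hv : IsTameField v) {s t : ℝ} (hs : s ∈ Ici (0 : ℝ))
    (ht : t ∈ Ici (0 : ℝ)) : E ≃ₜ E where
  toFun := hv.flow s t
  invFun := hv.flow t s
  left_inv x := by rw [hv.flow_flow ht hs ht, hv.flow_self ht]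
  right_inv x := by rw [hv.flow_flow hs ht hs, hv.flow_self hs]
  continuous_toFun := hv.continuous_flow hs ht
  continuous_invFun := hv.continuous_flow ht hs

variable {E : Type*} [NormedAddCommGroup E] [InnerProductSpace ℝ E] [FiniteDimensional ℝ E]
  [MeasurableSpace E] [BorelSpace E]

theorem IsPinchedPotential.map_flow_withDensity {V : E → ℝ} {p : E → E} {c C : ℝ}
    (h : IsPinchedPotential V p c C) {a : ℝ} (ha : 0 ≤ a) {s t : ℝ} (hs : 0 ≤ s) (ht : 0 ≤ t) :
    Measure.map (h.isTameField_heatField.flow s t)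
      (volume.withDensity fun x => ENNReal.ofReal (a * heatWeight V t x)) =
      volume.withDensity fun x => ENNReal.ofReal (a * heatWeight V s x) := by
  set hv := h.isTameField_heatField
  have hU : ∀ r, Continuous fun x => a * heatWeight V r x := fun r => continuous_const.mul
    (h.continuous_heatWeight.comp (by fun_prop : Continuous fun x : E => (r, x)))
  have := IsLocallyFiniteMeasure.withDensity_ofReal (μ := (volume : Measure E)) (hU s)
  have := IsLocallyFiniteMeasure.withDensity_ofReal (μ := (volume : Measure E)) (hU t)
  have : IsFiniteMeasureOnCompacts (Measure.map (hv.flow s t)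
      (volume.withDensity fun x => ENNReal.ofReal (a * heatWeight V t x))) :=
    Measure.IsFiniteMeasureOnCompacts.map _ (hv.flowHomeomorph (mem_Ici.2 hs) (mem_Ici.2 ht))
  have key : ∀ (r : ℝ) (f : E → ℝ≥0), Continuous f → HasCompactSupport f →
      ∫⁻ x, f x ∂(volume.withDensity fun x => ENNReal.ofReal (a * heatWeight V r x)) =
        ENNReal.ofReal (a * ∫ x, f x * heatWeight V r x) := fun r f hf hfc => by
    rw [lintegral_withDensity_eq_lintegral_mul _ (hU r).measurable.ennreal_ofReal
      hf.measurable.coe_nnreal_ennreal, ← integral_const_mul,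
      ofReal_integral_eq_lintegral_ofReal]
    · refine lintegral_congr fun x => ?_
      rw [Pi.mul_apply, mul_left_comm, ENNReal.ofReal_mul (NNReal.coe_nonneg _),
        ENNReal.ofReal_coe_nnreal, mul_comm]
    · simp only [mul_left_comm a]
      exact ((NNReal.continuous_coe.comp hf).mul (hU r)).integrable_of_hasCompactSupport
        ((hfc.comp_left NNReal.coe_zero).mul_right)
    · exact Filter.Eventually.of_forall fun x => mul_nonneg ha
        (mul_nonneg (NNReal.coe_nonneg _) (h.heatWeight_pos r x).le)
  refine Measure.ext_of_forall_lintegral_lipschitz_eq fun f K hf hfc => ?_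
  have hF := hv.continuous_flow (mem_Ici.2 hs) (mem_Ici.2 ht)
  rw [lintegral_map hf.continuous.measurable.coe_nnreal_ennreal hF.measurable,
    key s f hf.continuous hfc]
  refine (key t (fun x => f (hv.flow s t x)) (hf.continuous.comp hF)
    (hfc.comp_homeomorph (hv.flowHomeomorph (mem_Ici.2 hs) (mem_Ici.2 ht)))).trans ?_
  congr 2
  exact h.integral_comp_flow_mul_heatWeight (f := fun x => (f x : ℝ)) (L := K)
    (fun x y => hf x y) (hfc.comp_left NNReal.coe_zero) ht hs

end Pushforward

section HeatKernel

variable {E : Type*} [NormedAddCommGroup E] [InnerProductSpace ℝ E] [FiniteDimensional ℝ E]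
  [MeasurableSpace E] [BorelSpace E]

theorem heatWeight_zero (V : E → ℝ) (x : E) : heatWeight V 0 x = Real.exp (-V x) := by
  simp [heatWeight, gaussAverage]

theorem heatWeight_eq_integral (V : E → ℝ) {s : ℝ} (hs : 0 < s) (x : E) :
    heatWeight V s x = ∫ y, Real.exp (-V y) * ((2 * Real.pi * s) ^ (-(Module.finrank ℝ E : ℝ) / 2)
      * Real.exp (-‖x - y‖ ^ 2 / (2 * s))) := by
  have hr : 0 < √s := Real.sqrt_pos.2 hs
  set Φ : E → ℝ := fun y => gaussDensity ((√s)⁻¹ • y) * Real.exp (-V (x + y))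
  have h1 : heatWeight V s x = ∫ z, Φ (√s • z) := by
    rw [heatWeight, gaussAverage, integral_gaussMeasure]
    refine integral_congr_ae (Filter.Eventually.of_forall fun z => ?_)
    simp only [Φ, inv_smul_smul₀ hr.ne', smul_eq_mul]
  rw [h1, Measure.integral_comp_smul, smul_eq_mul, ← integral_const_mul]
  refine Eq.trans ?_ (integral_add_left_eq_self _ x)
  refine integral_congr_ae (Filter.Eventually.of_forall fun y => ?_)
  have h2 : |((√s) ^ Module.finrank ℝ E)⁻¹| = s ^ (-(Module.finrank ℝ E : ℝ) / 2) := by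
    rw [abs_of_pos (by positivity), Real.sqrt_eq_rpow, ← Real.rpow_natCast, ← Real.rpow_mul hs.le,
      ← Real.rpow_neg hs.le]
    congr 1
    ring
  have h3 : -(1 / 2) * ‖(√s)⁻¹ • y‖ ^ 2 = -‖y‖ ^ 2 / (2 * s) := by
    rw [norm_smul, norm_inv, Real.norm_of_nonneg hr.le, mul_pow, inv_pow, Real.sq_sqrt hs.le]
    field_simp
  simp only [Φ, gaussDensity, h2, h3, sub_add_cancel_left, norm_neg]
  rw [Real.mul_rpow (x := 2 * Real.pi) (by positivity) hs.le]
  ring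

end HeatKernel

/-- the transport flow between a Gibbs measure `μ = Z⁻¹ e^{−V} dx` with
`c ≤ HV ≤ C` on `ℝ^d` and its Gaussian regularizations. With `V_t = −log(e^{−V} * p_t)`
(`V₀ = V`) and `μ_t = Z⁻¹ e^{−V_t} dx`, there is a unique family `F_{s,t}` with
`F_{t,t} = id` and `∂_s F_{s,t} = (1/2) ∇V_s ∘ F_{s,t}`, it satisfies the flow composition
identities, and `(F_{s,t})_* μ_t = μ_s`. -/
theorem stmt19 (d : ℕ) (hd : 1 ≤ d) (c C : ℝ) (hc : 0 < c) (hcC : c ≤ C)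
    (V : EuclideanSpace ℝ (Fin d) → ℝ)
    (hconv : ConvexOn ℝ univ (fun x => V x - c / 2 * ‖x‖ ^ 2))
    (hconc : ConcaveOn ℝ univ (fun x => V x - C / 2 * ‖x‖ ^ 2))
    (Vt : ℝ → EuclideanSpace ℝ (Fin d) → ℝ)
    (hVt0 : Vt 0 = V)
    (hVt : ∀ t : ℝ, 0 < t → ∀ x,
      Vt t x = -Real.log (∫ y, Real.exp (-V y) *
        ((2 * Real.pi * t) ^ (-(d : ℝ) / 2) * Real.exp (-‖x - y‖ ^ 2 / (2 * t)))))
    (μt : ℝ → Measure (EuclideanSpace ℝ (Fin d)))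
    (hμt : ∀ t : ℝ, μt t = (volume : Measure (EuclideanSpace ℝ (Fin d))).withDensity
      (fun x => ENNReal.ofReal ((∫ y, Real.exp (-V y))⁻¹ * Real.exp (-(Vt t x))))) :
    ∃ Fmap : ℝ → ℝ → EuclideanSpace ℝ (Fin d) → EuclideanSpace ℝ (Fin d),
      -- (1) existence: the flow equations
      (∀ t ∈ Ici (0 : ℝ), ∀ x, Fmap t t x = x) ∧
      (∀ t ∈ Ici (0 : ℝ), ∀ x, ∀ s ∈ Ici (0 : ℝ),
        HasDerivWithinAt (fun s' => Fmap s' t x)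
          ((1 / 2 : ℝ) • gradient (Vt s) (Fmap s t x)) (Ici 0) s) ∧
      -- (1) uniqueness
      (∀ G : ℝ → ℝ → EuclideanSpace ℝ (Fin d) → EuclideanSpace ℝ (Fin d),
        (∀ t ∈ Ici (0 : ℝ), ∀ x, G t t x = x) →
        (∀ t ∈ Ici (0 : ℝ), ∀ x, ∀ s ∈ Ici (0 : ℝ),
          HasDerivWithinAt (fun s' => G s' t x)
            ((1 / 2 : ℝ) • gradient (Vt s) (G s t x)) (Ici 0) s) →
        ∀ s ∈ Ici (0 : ℝ), ∀ t ∈ Ici (0 : ℝ), ∀ x, G s t x = Fmap s t x) ∧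
      -- (2) composition and inverses
      (∀ t₁ ∈ Ici (0 : ℝ), ∀ t₂ ∈ Ici (0 : ℝ), ∀ t₃ ∈ Ici (0 : ℝ), ∀ x,
        Fmap t₁ t₂ (Fmap t₂ t₃ x) = Fmap t₁ t₃ x) ∧
      (∀ s ∈ Ici (0 : ℝ), ∀ t ∈ Ici (0 : ℝ), ∀ x,
        Fmap t s (Fmap s t x) = x) ∧
      -- (3) transport
      (∀ s ∈ Ici (0 : ℝ), ∀ t ∈ Ici (0 : ℝ),
        Measure.map (Fmap s t) (μt t) = μt s) := by
  obtain ⟨p, hp⟩ := exists_forall_quadratic_bounds hconv hconc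
  have h : IsPinchedPotential V p c C :=
    ⟨hc, hcC, fun x y => (hp x y).1, fun x y => (hp x y).2⟩
  have hVeq : ∀ s ∈ Ici (0 : ℝ), Vt s = fun x => -Real.log (heatWeight V s x) := by
    intro s hs
    funext x
    rcases (mem_Ici.1 hs).eq_or_lt with rfl | hs
    · rw [hVt0, heatWeight_zero, Real.log_exp, neg_neg]
    · rw [hVt s hs, heatWeight_eq_integral V hs, finrank_euclideanSpace_fin]
  have hμ : ∀ s ∈ Ici (0 : ℝ), μt s = volume.withDensity fun x =>
      ENNReal.ofReal ((∫ y, Real.exp (-V y))⁻¹ * heatWeight V s x) := by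
    intro s hs
    simp only [hμt s, hVeq s hs, neg_neg, Real.exp_log (h.heatWeight_pos s _)]
  have hgrad : ∀ s ∈ Ici (0 : ℝ), ∀ x, (1 / 2 : ℝ) • gradient (Vt s) x = heatField V p s x := by
    intro s hs x
    rw [hVeq s hs, (h.hasGradientAt_neg_log_heatWeight s x).gradient, heatField]
  set hv := h.isTameField_heatField
  refine ⟨hv.flow, fun t ht x => hv.flow_self ht x, fun t ht x s hs => ?_,
    fun G hG hG' s hs t ht x => ?_, fun t₁ h₁ t₂ h₂ t₃ h₃ x => hv.flow_flow h₁ h₂ h₃ x,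
    fun s hs t ht x => ?_, fun s hs t ht => ?_⟩
  · rw [hgrad s hs]
    exact hv.hasDerivWithinAt_flow ht x hs
  · refine hv.eq_flow (y := fun s => G s t x) ht (hG t ht x) (fun r hr => ?_) hs
    rw [← hgrad r hr]
    exact hG' t ht x r hr
  · rw [hv.flow_flow ht hs ht, hv.flow_self ht]
  · rw [hμ s hs, hμ t ht]
    exact h.map_flow_withDensity (inv_nonneg.2 (integral_nonneg fun _ => (Real.exp_pos _).le))
      hs ht
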